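/- Under Assumptions A, W and C, the constrained stochastic game possesses a Nash equilibrium in the set Φ of stationary multi-strategies. -/

import Mathlib

open MeasureTheory ProbabilityTheory Filter Topology
open scoped ENNReal NNReal

namespace CSGame

/-- The joint action space of the players. -/
abbrev JA {n : ℕ} (A : Fin n → Type) : Type := (i : Fin n) → A i

/-- The data of a constrained discounted stochastic Markov game:
countable state space `X`, Borel action spaces `A i` with compact admissible
action sets `As i x`, transition probability `p`, initial distribution `η`,
discount factor `α`, cost/constraint functions `c i ℓ` (`ℓ = 0` is the cost,
`ℓ ∈ L = {1,…,l}` are the constraints) and constraint bounds `κ i ℓ`. -/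
structure GameData (n l : ℕ) (X : Type) (A : Fin n → Type)
    [MeasurableSpace X] [∀ i, MeasurableSpace (A i)] [∀ i, TopologicalSpace (A i)] where
  As : (i : Fin n) → X → Set (A i)
  p : X → JA A → Measure X
  η : Measure X
  α : ℝ
  c : Fin n → Fin (l + 1) → X → JA A → ℝ
  κ : Fin n → Fin (l + 1) → ℝ
  hAs_ne : ∀ i x, (As i x).Nonempty
  hAs_cpt : ∀ i x, IsCompact (As i x)
  hp : ∀ x a, IsProbabilityMeasure (p x a)
  hpm : ∀ x y, Measurable fun a => p x a {y}
  hη : IsProbabilityMeasure η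
  hα0 : 0 < α
  hα1 : α < 1
  hc : ∀ i ℓ x, Measurable (c i ℓ x)

variable {n l : ℕ}
variable {X : Type} [Countable X] [MeasurableSpace X] [DiscreteMeasurableSpace X]
  [TopologicalSpace X] [DiscreteTopology X] [BorelSpace X] [SecondCountableTopology X]
variable {A : Fin n → Type} [∀ i, MeasurableSpace (A i)] [∀ i, TopologicalSpace (A i)]
  [∀ i, PolishSpace (A i)] [∀ i, BorelSpace (A i)]

/-- The set of feasible action profiles in state `x` (the section of `𝕂` at `x`). -/
def jointSet (G : GameData n l X A) (x : X) : Set (JA A) :=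
  Set.univ.pi fun i => G.As i x

/-- Histories of the game: `Hist X AA t` records the initial state and `t`
state-action transitions, ending with the current state (this is `H^{t+1}`). -/
def Hist (X AA : Type) : ℕ → Type
  | 0 => X
  | t + 1 => Hist X AA t × AA × X

noncomputable instance histMS (X AA : Type) [MeasurableSpace X] [MeasurableSpace AA] :
    ∀ t, MeasurableSpace (Hist X AA t)
  | 0 => inferInstanceAs (MeasurableSpace X)
  | t + 1 =>
      letI := histMS X AA t
      inferInstanceAs (MeasurableSpace (Hist X AA t × AA × X))

/-- The current (last) state of a history. -/
def lastState (X AA : Type) : ∀ t, Hist X AA t → X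
  | 0, h => h
  | _ + 1, h => h.2.2

theorem measurable_lastState (X AA : Type) [MeasurableSpace X] [MeasurableSpace AA] :
    ∀ t, Measurable (lastState X AA t)
  | 0 => measurable_id
  | _ + 1 => measurable_snd.comp measurable_snd

variable (G : GameData n l X A)

/-- A (history dependent, randomised) strategy of player `i`: a sequence of
transition probabilities from histories to the action space of player `i`,
concentrated on the admissible action set at the current state. -/
structure Strategy (i : Fin n) where
  f : ∀ t, Hist X (JA A) t → ProbabilityMeasure (A i)
  meas : ∀ t (s : Set (A i)), MeasurableSet s →
    Measurable fun h => (f t h : Measure (A i)) s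
  supp : ∀ t h, f t h (G.As i (lastState X (JA A) t h)) = 1

/-- A stationary strategy of player `i`: a transition probability from states to
actions, concentrated on the admissible action set. -/
def Stat (i : Fin n) : Type :=
  {φ : X → ProbabilityMeasure (A i) // ∀ x, φ x (G.As i x) = 1}

noncomputable instance (i : Fin n) : TopologicalSpace (Stat G i) :=
  inferInstanceAs (TopologicalSpace
    {φ : X → ProbabilityMeasure (A i) // ∀ x, φ x (G.As i x) = 1})

/-- Multi-strategies: one strategy for each player. -/
abbrev MultiStrategy : Type _ := ∀ i, Strategy G i

/-- Stationary multi-strategies (the set `Φ`). -/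
abbrev StatProfile : Type _ := ∀ i, Stat G i

noncomputable instance : TopologicalSpace (StatProfile G) :=
  inferInstanceAs (TopologicalSpace (∀ i, Stat G i))

/-- The strategy induced by a stationary strategy. -/
noncomputable def ofStat (i : Fin n) (φ : Stat G i) : Strategy G i where
  f := fun t h => φ.1 (lastState X (JA A) t h)
  meas := fun t _s _hs =>
    (Measurable.of_discrete (f := fun x => (φ.1 x : Measure (A i)) _s)).comp
      (measurable_lastState X (JA A) t)
  supp := fun t h => φ.2 _

/-- The multi-strategy induced by a stationary multi-strategy. -/
noncomputable def ofStatAll (φ : StatProfile G) : MultiStrategy G :=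
  fun i => ofStat G i (φ i)

/-- `[π_{-i}, σ]` : player `i` deviates to `σ`, the others keep `π`. -/
noncomputable def combine (π : MultiStrategy G) (i : Fin n) (σ : Strategy G i) :
    MultiStrategy G :=
  Function.update π i σ

/-- `[φ_{-i}, γ]` for stationary profiles. -/
noncomputable def updStat (φ : StatProfile G) (i : Fin n) (γ : Stat G i) :
    StatProfile G :=
  Function.update φ i γ

/-- The joint (product) distribution of the players' actions after history `h`. -/
noncomputable def jointLaw (π : MultiStrategy G) (t : ℕ) (h : Hist X (JA A) t) :
    Measure (JA A) :=
  Measure.pi fun i => ((π i).f t h : Measure (A i))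

/-- The distribution of histories of length `t` under the multi-strategy `π`,
the transition probability `G.p` and the initial distribution `η'`
(the finite-dimensional marginals of the Ionescu–Tulcea measure `P^π_{η'}`). -/
noncomputable def histMeas (η' : Measure X) (π : MultiStrategy G) :
    ∀ t, Measure (Hist X (JA A) t)
  | 0 => η'
  | t + 1 =>
      (histMeas η' π t).bind fun h =>
        (jointLaw G π t h).bind fun a =>
          (G.p (lastState X (JA A) t h) a).map fun y =>
            (show Hist X (JA A) (t + 1) from (h, a, y))

/-- Expected value of `f (x^{t+1}, a^{t+1})` under `π` (states enumerated from `1`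
in the paper, from `0` here). -/
noncomputable def stageExp (η' : Measure X) (π : MultiStrategy G) (t : ℕ)
    (f : X → JA A → ℝ) : ℝ :=
  ∫ h, (∫ a, f (lastState X (JA A) t h) a ∂(jointLaw G π t h)) ∂(histMeas G η' π t)

/-- The expected discounted cost functional
`J(π) = (1-α) E^π_{η'} [∑_{t≥1} α^{t-1} f(x^t,a^t)]`. -/
noncomputable def Jfun (η' : Measure X) (f : X → JA A → ℝ) (π : MultiStrategy G) : ℝ :=
  (1 - G.α) * ∑' t : ℕ, G.α ^ t * stageExp G η' π t f

/-- `J_i^ℓ(π)` of the paper. -/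
noncomputable def J (i : Fin n) (ℓ : Fin (l + 1)) (π : MultiStrategy G) : ℝ :=
  Jfun G G.η (G.c i ℓ) π

/-- `π_i ∈ Δ_i(π_{-i})` : all constraints of player `i` are satisfied. -/
def Feas (i : Fin n) (π : MultiStrategy G) : Prop :=
  ∀ ℓ : Fin (l + 1), ℓ ≠ 0 → J G i ℓ π ≤ G.κ i ℓ

/-- Expectation of `w(x^{t+1})` (as an extended nonnegative real). -/
noncomputable def wStateExp (η' : Measure X) (π : MultiStrategy G) (t : ℕ)
    (w : X → ℝ) : ℝ≥0∞ :=
  ∫⁻ h, ENNReal.ofReal (w (lastState X (JA A) t h)) ∂(histMeas G η' π t)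

/-- Assumption A(i): continuity of the transition probability in the actions. -/
def AssumptionA1 : Prop :=
  ∀ x y, ContinuousOn (fun a => G.p x a {y}) (jointSet G x)

/-- Assumption A: continuity of the transition probability and of the
cost/constraint functions in the actions. -/
def AssumptionA : Prop :=
  AssumptionA1 G ∧ ∀ i ℓ x, ContinuousOn (G.c i ℓ x) (jointSet G x)

/-- Assumption B for the weight function `w`: `w ≥ 1` bounds all the costs on `𝕂`,
the discounted tails `sup_π (1-α) E^π_η[∑_{t≥k} α^{t-1} w(x^t)]` vanish as `k → ∞`,
and for each stage `t` the family `{w(x^t)}` is uniformly integrable over all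
multi-strategies. -/
def AssumptionB (w : X → ℝ) : Prop :=
  (∀ x, 1 ≤ w x) ∧
  (∀ i ℓ x a, a ∈ jointSet G x → |G.c i ℓ x a| ≤ w x) ∧
  Tendsto (fun k : ℕ => ⨆ π : MultiStrategy G,
      ENNReal.ofReal (1 - G.α) *
        ∑' t : ℕ, ENNReal.ofReal G.α ^ (k + t) * wStateExp G G.η π (k + t) w)
    atTop (𝓝 0) ∧
  ∀ t : ℕ, Tendsto (fun k : ℕ => ⨆ π : MultiStrategy G,
      ∫⁻ h in {h | (k : ℝ) ≤ w (lastState X (JA A) t h)},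
        ENNReal.ofReal (w (lastState X (JA A) t h)) ∂(histMeas G G.η π t))
    atTop (𝓝 0)

/-- Assumption C (Slater condition). -/
def AssumptionC : Prop :=
  ∀ (φ : StatProfile G) (i : Fin n), ∃ π : Strategy G i,
    ∀ ℓ : Fin (l + 1), ℓ ≠ 0 → J G i ℓ (combine G (ofStatAll G φ) i π) < G.κ i ℓ

/-- Assumption D: the initial distribution charges every state. -/
def AssumptionD : Prop :=
  ∀ x : X, 0 < G.η {x}

/-- Assumption W (weighted-norm conditions of Wessels). -/
def AssumptionW (w : X → ℝ) : Prop :=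
  (∀ x, 1 ≤ w x) ∧
  (∀ i ℓ x a, a ∈ jointSet G x → |G.c i ℓ x a| ≤ w x) ∧
  (∃ δ : ℝ, 1 ≤ δ ∧ δ * G.α < 1 ∧ ∀ x a, a ∈ jointSet G x →
      ∫⁻ y, ENNReal.ofReal (w y) ∂(G.p x a) ≤ ENNReal.ofReal (δ * w x)) ∧
  (∀ x, ContinuousOn (fun a => ∫⁻ y, ENNReal.ofReal (w y) ∂(G.p x a)) (jointSet G x)) ∧
  (∫⁻ y, ENNReal.ofReal (w y) ∂G.η) < ⊤

/-- All cost and constraint functions are bounded. -/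
def BoundedCosts : Prop :=
  ∀ i (ℓ : Fin (l + 1)), ∃ C : ℝ, ∀ x a, |G.c i ℓ x a| ≤ C

/-- A stationary multi-strategy `φ` is a Nash equilibrium of the constrained game:
it is feasible, and no player can lower his discounted cost by a unilateral
deviation to any (history dependent) strategy satisfying his constraints. -/
def IsNashStat (φ : StatProfile G) : Prop :=
  (∀ i, Feas G i (ofStatAll G φ)) ∧
  ∀ (i : Fin n) (σ : Strategy G i), Feas G i (combine G (ofStatAll G φ) i σ) →
    J G i 0 (ofStatAll G φ) ≤ J G i 0 (combine G (ofStatAll G φ) i σ)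

section Occupation

/-- A correlated strategy of the players. -/
structure CorrStrategy where
  f : ∀ t, Hist X (JA A) t → ProbabilityMeasure (JA A)
  meas : ∀ t (s : Set (JA A)), MeasurableSet s →
    Measurable fun h => (f t h : Measure (JA A)) s
  supp : ∀ t h, f t h (jointSet G (lastState X (JA A) t h)) = 1

/-- History distributions under a correlated strategy. -/
noncomputable def histMeasC (π : CorrStrategy G) : ∀ t, Measure (Hist X (JA A) t)
  | 0 => G.η
  | t + 1 =>
      (histMeasC π t).bind fun h =>
        ((π.f t h : Measure (JA A))).bind fun a =>
          (G.p (lastState X (JA A) t h) a).map fun y =>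
            (show Hist X (JA A) (t + 1) from (h, a, y))

/-- The occupation measure `ρ(K') = (1-α) E^π_η [∑_{t≥1} α^{t-1} 1_{K'}(x^t,a^t)]`
of a correlated strategy, as a measure on the state–action pairs. -/
noncomputable def occ (π : CorrStrategy G) : Measure (X × JA A) :=
  ENNReal.ofReal (1 - G.α) •
    Measure.sum fun t : ℕ => ENNReal.ofReal G.α ^ t •
      ((histMeasC G π t).bind fun h =>
        (π.f t h : Measure (JA A)).map fun a => (lastState X (JA A) t h, a))

/-- The set `𝓜` of occupation measures of correlated strategies. -/
def OccSet : Set (ProbabilityMeasure (X × JA A)) :=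
  {ρ | ∃ π : CorrStrategy G, (ρ : Measure (X × JA A)) = occ G π}

/-- Projection of a state–action pair onto the coordinates of player `i`. -/
def projAct (i : Fin n) : X × JA A → X × A i := fun q => (q.1, q.2 i)

/-- The set `𝓜_i` of statewise projections of occupation measures onto `𝕂_i`. -/
def MiSet (i : Fin n) : Set (ProbabilityMeasure (X × A i)) :=
  {μ | ∃ ρ ∈ OccSet G, (μ : Measure (X × A i)) = (ρ : Measure (X × JA A)).map (projAct i)}

/-- The marginal `μ̂(x) = μ({x} × A_i(x))`. -/
noncomputable def marg (i : Fin n) (μ : ProbabilityMeasure (X × A i)) (x : X) : ℝ≥0∞ :=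
  (μ : Measure (X × A i)) ({x} ×ˢ G.As i x)

/-- `μ = μ̂ φ` : `φ` disintegrates `μ`, i.e. `μ({x} × B) = φ(B|x) μ̂(x)`. -/
def Disint (i : Fin n) (μ : ProbabilityMeasure (X × A i)) (φ : Stat G i) : Prop :=
  ∀ x (B : Set (A i)), MeasurableSet B → B ⊆ G.As i x →
    (μ : Measure (X × A i)) ({x} ×ˢ B) = (φ.1 x B : ℝ≥0∞) * marg G i μ x

/-- The occupation measure on state–action pairs of a multi-strategy. -/
noncomputable def occMulti (η' : Measure X) (π : MultiStrategy G) : Measure (X × JA A) :=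
  ENNReal.ofReal (1 - G.α) •
    Measure.sum fun t : ℕ => ENNReal.ofReal G.α ^ t •
      ((histMeas G η' π t).bind fun h =>
        (jointLaw G π t h).map fun a => (lastState X (JA A) t h, a))

end Occupation

section COP

/-- The product distribution on action profiles in state `x` in which player `i`
plays the fixed action `ai` and every player `j ≠ i` plays `φ j`. -/
noncomputable def statJoint (φ : StatProfile G) (i : Fin n) (x : X) (ai : A i) :
    Measure (JA A) :=
  Measure.pi fun j =>
    if h : j = i then Measure.dirac (cast (congrArg A h.symm) ai)
    else ((φ j).1 x : Measure (A j))

/-- `c_i^ℓ(x, [φ_{-i}(x), a_i])`. -/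
noncomputable def cbar (φ : StatProfile G) (i : Fin n) (ℓ : Fin (l + 1)) (x : X)
    (ai : A i) : ℝ :=
  ∫ a, G.c i ℓ x a ∂(statJoint G φ i x ai)

/-- `p(y | x, [φ_{-i}(x), a_i])`. -/
noncomputable def pbar (φ : StatProfile G) (i : Fin n) (y x : X) (ai : A i) : ℝ≥0∞ :=
  ∫⁻ a, G.p x a {y} ∂(statJoint G φ i x ai)

/-- Feasibility in the constrained optimisation problem `COP(φ_{-i})`:
`μ ∈ Pr(𝕂_i)` satisfies the constraint inequalities and the characteristic
equations of occupation measures. -/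
def COPFeasible (φ : StatProfile G) (i : Fin n)
    (μ : ProbabilityMeasure (X × A i)) : Prop :=
  (μ : Measure (X × A i)) {q : X × A i | q.2 ∈ G.As i q.1} = 1 ∧
  (∀ ℓ : Fin (l + 1), ℓ ≠ 0 →
    ∫ q : X × A i, cbar G φ i ℓ q.1 q.2 ∂(μ : Measure (X × A i)) ≤ G.κ i ℓ) ∧
  ∀ x : X, (μ : Measure (X × A i)) ({x} ×ˢ G.As i x) =
    ENNReal.ofReal (1 - G.α) * G.η {x} +
      ENNReal.ofReal G.α *
        ∫⁻ q : X × A i, pbar G φ i x q.1 q.2 ∂(μ : Measure (X × A i))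

/-- The objective of `COP(φ_{-i})`. -/
noncomputable def COPObj (φ : StatProfile G) (i : Fin n)
    (μ : ProbabilityMeasure (X × A i)) : ℝ :=
  ∫ q : X × A i, cbar G φ i 0 q.1 q.2 ∂(μ : Measure (X × A i))

/-- The solution set `𝓞_i(φ_{-i})` of `COP(φ_{-i})`. -/
def COPSol (φ : StatProfile G) (i : Fin n) : Set (ProbabilityMeasure (X × A i)) :=
  {μ | COPFeasible G φ i μ ∧
    ∀ ν, COPFeasible G φ i ν → COPObj G φ i μ ≤ COPObj G φ i ν}

end COP

section Perturbed

/-- `η̃` is a probability measure charging exactly the `η`-null states `X_0`. -/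
def IsPerturb (ηt : Measure X) : Prop :=
  IsProbabilityMeasure ηt ∧ (∀ x, G.η {x} = 0 → 0 < ηt {x}) ∧
    ∀ x, G.η {x} ≠ 0 → ηt {x} = 0

/-- The perturbed initial distribution `η(m) = (1 - 1/m) η + (1/m) η̃`. -/
noncomputable def etam (ηt : Measure X) (m : ℕ) : Measure X :=
  ENNReal.ofReal (1 - 1 / (m : ℝ)) • G.η + ENNReal.ofReal (1 / (m : ℝ)) • ηt

/-- The truncation `c_i^{ℓ,m}` of `c_i^ℓ` at the level `√m`. -/
noncomputable def ctrunc (i : Fin n) (ℓ : Fin (l + 1)) (m : ℕ) (x : X) (a : JA A) : ℝ :=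
  max (-Real.sqrt m) (min (G.c i ℓ x a) (Real.sqrt m))

/-- `J_i^{ℓ,η(m)}`: discounted cost with truncated costs and perturbed initial
distribution. -/
noncomputable def Jm (ηt : Measure X) (m : ℕ) (i : Fin n) (ℓ : Fin (l + 1))
    (π : MultiStrategy G) : ℝ :=
  Jfun G (etam G ηt m) (ctrunc G i ℓ m) π

/-- The perturbed constraint bounds `κ_i^{ℓ,m} = (1 - 1/m) κ_i^ℓ + 1/√m`. -/
noncomputable def kappam (i : Fin n) (ℓ : Fin (l + 1)) (m : ℕ) : ℝ :=
  (1 - 1 / (m : ℝ)) * G.κ i ℓ + 1 / Real.sqrt m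

/-- `π_i ∈ Δ_i^m(π_{-i})` : the constraints of the `m`-CSG hold. -/
def FeasM (ηt : Measure X) (m : ℕ) (i : Fin n) (π : MultiStrategy G) : Prop :=
  ∀ ℓ : Fin (l + 1), ℓ ≠ 0 → Jm G ηt m i ℓ π ≤ kappam G i ℓ m

end Perturbed

end CSGame


namespace CSGame

section Scarf

set_option linter.unusedSectionVars false

variable {T I : Type} [Fintype T] [DecidableEq T] [Fintype I] [DecidableEq I]

/-- Dominant sets in the sense of Scarf. -/
def Dom (key : I → T → ℕ) (S : Finset T) : Prop :=
  ∀ y, ∃ i, ∀ x ∈ S, key i y ≤ key i x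

theorem Dom.mono {key : I → T → ℕ} {S D : Finset T} (h : Dom key S) (hD : D ⊆ S) : Dom key D :=
  fun y => let ⟨i, hi⟩ := h y; ⟨i, fun x hx => hi x (hD hx)⟩

theorem exists_argmin {key : I → T → ℕ} {D : Finset T} (hD : D.Nonempty) :
    ∃ mn : I → T, ∀ i, mn i ∈ D ∧ ∀ x ∈ D, key i (mn i) ≤ key i x := by
  have : ∀ i, ∃ m ∈ D, ∀ x ∈ D, key i m ≤ key i x := fun i =>
    Finset.exists_min_image D (key i) hD
  choose mn h1 h2 using this
  exact ⟨mn, fun i => ⟨h1 i, h2 i⟩⟩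

theorem argmin_surj {key : I → T → ℕ} (hk : ∀ i, Function.Injective (key i)) {D : Finset T}
    (hdom : Dom key D) {mn : I → T} (hmn : ∀ i, mn i ∈ D ∧ ∀ x ∈ D, key i (mn i) ≤ key i x) :
    ∀ x ∈ D, ∃ i, mn i = x := by
  intro x hx
  obtain ⟨i, hi⟩ := hdom x
  exact ⟨i, hk i (le_antisymm ((hmn i).2 x hx) (hi _ (hmn i).1))⟩

/-- Room side of the parity argument. -/
theorem room_even (c : T → I) (i0 : I) (S : Finset T) (hS : S.card = Fintype.card I)
    (hnc : S.image c ≠ Finset.univ) :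
    Even ({x ∈ S | (S.erase x).image c = Finset.univ.erase i0} : Finset T).card := by
  classical
  by_cases hex : ∃ x ∈ S, (S.erase x).image c = Finset.univ.erase i0
  swap
  · have : ({x ∈ S | (S.erase x).image c = Finset.univ.erase i0} : Finset T) = ∅ := by
      ext x; simp only [Finset.mem_filter, Finset.notMem_empty, iff_false]
      exact fun h => hex ⟨x, h.1, h.2⟩
    rw [this]; simp
  obtain ⟨x, hx, hxi⟩ := hex
  have hcx : c x ≠ i0 := by
    intro h
    apply hnc
    rw [← Finset.insert_erase hx, Finset.image_insert, hxi, h]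
    simp
  have hinj : Set.InjOn c (S.erase x : Finset T) := by
    rw [← Finset.card_image_iff, hxi, Finset.card_erase_of_mem hx, hS,
      Finset.card_erase_of_mem (Finset.mem_univ _), Finset.card_univ]
  have : c x ∈ (S.erase x).image c := by rw [hxi]; simp [hcx]
  obtain ⟨x', hx', hcx'⟩ := Finset.mem_image.1 this
  have hne : x ≠ x' := fun h => by simp [← h] at hx'
  have : ({x ∈ S | (S.erase x).image c = Finset.univ.erase i0} : Finset T) = {x, x'} := by
    ext y
    simp only [Finset.mem_filter, Finset.mem_insert, Finset.mem_singleton]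
    constructor
    · rintro ⟨hy, hyi⟩
      by_contra hcon
      push Not at hcon
      have hyx : y ∈ S.erase x := Finset.mem_erase.2 ⟨hcon.1, hy⟩
      have : c y ∈ (S.erase y).image c := by
        rw [hyi, ← hxi]; exact Finset.mem_image_of_mem _ hyx
      obtain ⟨z, hz, hzc⟩ := Finset.mem_image.1 this
      by_cases hzx : z = x
      · subst hzx
        exact hcon.2 (hinj hyx hx' (by rw [← hzc, hcx']))
      · have := hinj (Finset.mem_coe.2 (Finset.mem_erase.2 ⟨hzx, Finset.mem_of_mem_erase hz⟩)) hyx hzc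
        simp [this] at hz
    · rintro (rfl | rfl)
      · exact ⟨hx, hxi⟩
      · refine ⟨Finset.mem_of_mem_erase hx', ?_⟩
        rw [← hxi]
        ext k
        simp only [Finset.mem_image, Finset.mem_erase]
        constructor
        · rintro ⟨z, ⟨hz1, hz2⟩, rfl⟩
          by_cases hzx : z = x
          · exact ⟨y, ⟨hne.symm, Finset.mem_of_mem_erase hx'⟩, by rw [hcx', hzx]⟩
          · exact ⟨z, ⟨hzx, hz2⟩, rfl⟩
        · rintro ⟨z, ⟨hz1, hz2⟩, rfl⟩
          by_cases hzx : z = y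
          · exact ⟨x, ⟨hne, hx⟩, by rw [← hcx', hzx]⟩
          · exact ⟨z, ⟨hzx, hz2⟩, rfl⟩
  rw [this, Finset.card_pair hne]
  exact even_two

/-- Door side, interior doors: exactly two rooms. -/
theorem door_two {key : I → T → ℕ} (hk : ∀ i, Function.Injective (key i)) {s : I → T}
    (hs2 : ∀ i j t, j ≠ i → t ∉ Set.range s → key i t < key i (s j))
    {D : Finset T} (hc : D.card + 1 = Fintype.card I) (hdom : Dom key D)
    {d : T} (hd : d ∈ D) (hds : d ∉ Set.range s) :
    ∃ y y' : T, y ∉ D ∧ y' ∉ D ∧ y ≠ y' ∧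
      ∀ z, z ∉ D → (Dom key (insert z D) ↔ z = y ∨ z = y') := by
  classical
  obtain ⟨mn, hmn⟩ := exists_argmin (key := key) ⟨d, hd⟩
  have hsurj := argmin_surj hk hdom hmn
  obtain ⟨i, -, j, -, hij, hmij⟩ := Finset.exists_ne_map_eq_of_card_lt_of_maps_to
    (s := (Finset.univ : Finset I)) (t := D) (f := mn) (by rw [Finset.card_univ]; omega)
    (fun i _ => (hmn i).1)
  have ha : ∀ k, k = i ∨ k = j → ∀ x ∈ D, ∃ l, l ≠ k ∧ mn l = x := by
    intro k hk' x hx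
    obtain ⟨l, hl⟩ := hsurj x hx
    by_cases hlk : l = k
    · rcases hk' with h | h
      · exact ⟨j, by rw [h]; exact hij.symm, by rw [← hmij, ← h, ← hlk, hl]⟩
      · exact ⟨i, by rw [h]; exact hij, by rw [hmij, ← h, ← hlk, hl]⟩
    · exact ⟨l, hlk, hl⟩
  have hb : ∀ k, (∀ x ∈ D, ∃ l, l ≠ k ∧ mn l = x) → k = i ∨ k = j := by
    intro k h
    by_contra hcon
    push Not at hcon
    have hinj : Set.InjOn mn (Finset.univ.erase k : Finset I) := by
      apply Finset.injOn_of_surjOn_of_card_le (t := D) mn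
      · intro l _; exact (hmn l).1
      · intro x hx
        obtain ⟨l, hl, hlx⟩ := h x hx
        exact ⟨l, by simpa using hl, hlx⟩
      · rw [Finset.card_erase_of_mem (Finset.mem_univ _), Finset.card_univ]; omega
    exact hij (hinj (by simpa using hcon.1.symm) (by simpa using hcon.2.symm) hmij)
  -- the pivot
  have hpiv : ∀ k, ∃ y, (∀ l, l ≠ k → key l (mn l) < key l y) ∧
      ∀ z, (∀ l, l ≠ k → key l (mn l) < key l z) → key k z ≤ key k y := by
    intro k
    obtain ⟨y, hy, hy'⟩ := Finset.exists_max_image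
      (Finset.univ.filter fun y => ∀ l, l ≠ k → key l (mn l) < key l y) (key k)
      ⟨s k, by
        simp only [Finset.mem_filter, Finset.mem_univ, true_and]
        intro l hl
        exact lt_of_le_of_lt ((hmn l).2 d hd) (hs2 l k d hl.symm hds)⟩
    simp only [Finset.mem_filter, Finset.mem_univ, true_and] at hy hy'
    exact ⟨y, hy, hy'⟩
  choose Y hY1 hY2 using hpiv
  have hYD : ∀ k, k = i ∨ k = j → Y k ∉ D := by
    intro k hk' hmem
    obtain ⟨l, hl, hlx⟩ := ha k hk' _ hmem
    have := hY1 k l hl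
    rw [hlx] at this
    exact lt_irrefl _ this
  have hYdom : ∀ k, Dom key (insert (Y k) D) := by
    intro k z
    by_cases hz : ∀ l, l ≠ k → key l (mn l) < key l z
    · refine ⟨k, ?_⟩
      intro x hx
      rcases Finset.mem_insert.1 hx with rfl | hx
      · exact hY2 k z hz
      · obtain ⟨l, hl⟩ := hdom z
        by_cases hlk : l = k
        · rw [← hlk]; exact hl x hx
        · exact absurd (hz l hlk) (not_lt.2 (hl _ (hmn l).1))
    · push Not at hz
      obtain ⟨l, hlk, hl⟩ := hz
      refine ⟨l, ?_⟩
      intro x hx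
      rcases Finset.mem_insert.1 hx with rfl | hx
      · exact hl.trans (hY1 k l hlk).le
      · exact hl.trans ((hmn l).2 x hx)
  refine ⟨Y i, Y j, hYD i (Or.inl rfl), hYD j (Or.inr rfl), ?_, ?_⟩
  · intro h
    obtain ⟨l, hl⟩ := hdom (Y i)
    have h1 := hl _ (hmn l).1
    by_cases hli : l = i
    · have := hY1 j l (by rw [hli]; exact hij)
      rw [← h] at this
      omega
    · have := hY1 i l hli
      omega
  · intro y hyD
    constructor
    swap
    · rintro (rfl | rfl)
      · exact hYdom i
      · exact hYdom j
    intro hS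
    obtain ⟨m, hm⟩ := exists_argmin (key := key) (Finset.insert_nonempty y D)
    have hms := argmin_surj hk hS hm
    have hminj : Set.InjOn m (Finset.univ : Finset I) := by
      apply Finset.injOn_of_surjOn_of_card_le (t := insert y D) m
      · intro l _; exact (hm l).1
      · intro x hx
        obtain ⟨l, hl⟩ := hms x hx
        exact ⟨l, by simp, hl⟩
      · rw [Finset.card_insert_of_notMem hyD, Finset.card_univ, hc]
    obtain ⟨k, hk1⟩ := hms y (Finset.mem_insert_self _ _)
    have hkmin : ∀ x ∈ insert y D, key k y ≤ key k x := fun x hx => by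
      have := (hm k).2 x hx
      rwa [hk1] at this
    have hyM : ∀ l, l ≠ k → key l (mn l) < key l y := by
      intro l hl
      by_contra hcon
      push Not at hcon
      apply hl
      apply hminj (by simp) (by simp)
      rw [hk1]
      apply hk l
      apply le_antisymm ((hm l).2 y (Finset.mem_insert_self _ _))
      rcases Finset.mem_insert.1 (hm l).1 with h | h
      · rw [h]
      · exact hcon.trans ((hmn l).2 _ h)
    have hkij : k = i ∨ k = j := by
      apply hb
      intro x hx
      obtain ⟨l, hl⟩ := hms x (Finset.mem_insert_of_mem hx)
      refine ⟨l, ?_, ?_⟩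
      · rintro rfl
        rw [hk1] at hl
        exact hyD (hl ▸ hx)
      · apply hk l
        apply le_antisymm ((hmn l).2 x hx)
        rw [← hl]
        exact (hm l).2 _ (Finset.mem_insert_of_mem (hmn l).1)
    have hyk : y = Y k := by
      apply hk k
      apply le_antisymm (hY2 k y hyM)
      obtain ⟨l, hl⟩ := hS (Y k)
      by_cases hlk : l = k
      · subst hlk; exact hl y (Finset.mem_insert_self _ _)
      · exact absurd (hY1 k l hlk) (not_lt.2 (hl _ (Finset.mem_insert_of_mem (hmn l).1)))
    rcases hkij with h | h
    · left; rw [hyk, h]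
    · right; rw [hyk, h]

/-- Door side, the unique boundary door: exactly one room. -/
theorem door_one {key : I → T → ℕ} (hk : ∀ i, Function.Injective (key i)) {s : I → T}
    (hs1 : ∀ i t, t ≠ s i → key i (s i) < key i t)
    (hs2 : ∀ i j t, j ≠ i → t ∉ Set.range s → key i t < key i (s j))
    (hT : ∃ t, t ∉ Set.range s) (i0 : I) :
    ∃ y, y ∉ (Finset.univ.erase i0).image s ∧
      ∀ z, z ∉ (Finset.univ.erase i0).image s →
        (Dom key (insert z ((Finset.univ.erase i0).image s)) ↔ z = y) := by
  classical
  obtain ⟨t0, ht0⟩ := hT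
  obtain ⟨y, hy, hy'⟩ := Finset.exists_max_image
    (Finset.univ.filter fun y => y ∉ Set.range s) (key i0) ⟨t0, by simpa using ht0⟩
  simp only [Finset.mem_filter, Finset.mem_univ, true_and] at hy hy'
  have hle : ∀ i t, key i (s i) ≤ key i t := by
    intro i t
    by_cases h : t = s i
    · rw [h]
    · exact (hs1 i t h).le
  have hyD : y ∉ (Finset.univ.erase i0).image s := by
    intro h
    obtain ⟨j, -, hj⟩ := Finset.mem_image.1 h
    exact hy ⟨j, hj⟩
  refine ⟨y, hyD, fun z hz => ⟨fun hS => ?_, ?_⟩⟩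
  · have hzs : z ∉ Set.range s := by
      rintro ⟨j, rfl⟩
      have hj : j = i0 := by
        by_contra h
        exact hz (Finset.mem_image_of_mem _ (by simpa using h))
      subst hj
      obtain ⟨i, hi⟩ := hS t0
      have hmem : s i ∈ insert (s j) ((Finset.univ.erase j).image s) := by
        by_cases h : i = j
        · subst h; exact Finset.mem_insert_self _ _
        · exact Finset.mem_insert_of_mem (Finset.mem_image_of_mem _ (by simpa using h))
      exact absurd (hs1 i t0 (fun h => ht0 ⟨i, h.symm⟩)) (not_lt.2 (hi _ hmem))
    obtain ⟨i, hi⟩ := hS y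
    by_cases h : i = i0
    · subst h
      exact hk i (le_antisymm (hy' z hzs) (hi z (Finset.mem_insert_self _ _)))
    · exact absurd (hs1 i y (fun h => hy ⟨i, h.symm⟩))
        (not_lt.2 (hi _ (Finset.mem_insert_of_mem (Finset.mem_image_of_mem _ (by simpa using h)))))
  · rintro rfl x
    by_cases hx : x ∈ Set.range s
    · obtain ⟨j, rfl⟩ := hx
      exact ⟨j, fun t _ => hle j t⟩
    · refine ⟨i0, fun t ht => ?_⟩
      rcases Finset.mem_insert.1 ht with rfl | ht
      · exact hy' x hx
      · obtain ⟨j, hj, rfl⟩ := Finset.mem_image.1 ht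
        exact (hs2 i0 j x (by simpa using hj) hx).le

/-- Scarf's combinatorial lemma. -/
theorem scarf [Nonempty I] {key : I → T → ℕ} (hk : ∀ i, Function.Injective (key i)) {s : I → T}
    (hs1 : ∀ i t, t ≠ s i → key i (s i) < key i t)
    (hs2 : ∀ i j t, j ≠ i → t ∉ Set.range s → key i t < key i (s j))
    (hT : ∃ t, t ∉ Set.range s) (c : T → I) (hcs : ∀ i, c (s i) = i) :
    ∃ S : Finset T, S.card = Fintype.card I ∧ Dom key S ∧ S.image c = Finset.univ := by
  classical
  by_contra hcon
  push Not at hcon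
  obtain ⟨i0⟩ := ‹Nonempty I›
  have hsinj : Function.Injective s := fun i j h => by rw [← hcs i, h, hcs]
  have hpos : 0 < Fintype.card I := Fintype.card_pos_iff.2 ⟨i0⟩
  let R : Finset (Finset T) := Finset.univ.filter fun S => S.card = Fintype.card I ∧ Dom key S
  let Ds : Finset (Finset T) := Finset.univ.filter fun D =>
    D.card + 1 = Fintype.card I ∧ Dom key D ∧ D.image c = Finset.univ.erase i0
  have hdc := Finset.sum_card_bipartiteAbove_eq_sum_card_bipartiteBelow
    (s := Ds) (t := R) (fun D S => D ⊆ S)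
  -- room side
  have hroom : Even (∑ S ∈ R, (Finset.bipartiteBelow (fun D S => D ⊆ S) Ds S).card) := by
    apply Finset.even_sum
    intro S hS
    simp only [R, Finset.mem_filter, Finset.mem_univ, true_and] at hS
    have hev := room_even c i0 S hS.1 (hcon S hS.1 hS.2)
    suffices h : ({x ∈ S | (S.erase x).image c = Finset.univ.erase i0} : Finset T).card =
        (Finset.bipartiteBelow (fun D S => D ⊆ S) Ds S).card by rwa [h] at hev
    apply Finset.card_bij (fun x _ => S.erase x)
    · intro x hx
      simp only [Finset.mem_filter] at hx
      simp only [Finset.bipartiteBelow, Ds, Finset.mem_filter, Finset.mem_univ, true_and]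
      refine ⟨⟨?_, hS.2.mono (Finset.erase_subset _ _), hx.2⟩, Finset.erase_subset _ _⟩
      rw [Finset.card_erase_of_mem hx.1]; omega
    · intro x hx y hy hxy
      simp only [Finset.mem_filter] at hx hy
      by_contra hne
      have : x ∈ S.erase y := Finset.mem_erase.2 ⟨hne, hx.1⟩
      rw [← hxy] at this
      simp at this
    · intro D hD
      simp only [Finset.bipartiteBelow, Ds, Finset.mem_filter, Finset.mem_univ, true_and] at hD
      obtain ⟨⟨h1, h2, h3⟩, h4⟩ := hD
      obtain ⟨x, hx⟩ : (S \ D).Nonempty := by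
        rw [← Finset.card_pos, Finset.card_sdiff_of_subset h4]; omega
      rw [Finset.mem_sdiff] at hx
      have hDe : S.erase x = D := by
        symm
        apply Finset.eq_of_subset_of_card_le
        · intro z hz
          exact Finset.mem_erase.2 ⟨fun h => hx.2 (h ▸ hz), h4 hz⟩
        · rw [Finset.card_erase_of_mem hx.1]; omega
      exact ⟨x, by simp only [Finset.mem_filter]; exact ⟨hx.1, by rw [hDe, h3]⟩, hDe⟩
  -- rooms above a door are parametrised by the added vertex
  have hab : ∀ D ∈ Ds, (Finset.bipartiteAbove (fun D S => D ⊆ S) R D).card =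
      (Finset.univ.filter fun z => z ∉ D ∧ Dom key (insert z D)).card := by
    intro D hD
    simp only [Ds, Finset.mem_filter, Finset.mem_univ, true_and] at hD
    symm
    apply Finset.card_bij (fun z _ => insert z D)
    · intro z hz
      simp only [Finset.mem_filter, Finset.mem_univ, true_and] at hz
      simp only [Finset.bipartiteAbove, R, Finset.mem_filter, Finset.mem_univ, true_and]
      exact ⟨⟨by rw [Finset.card_insert_of_notMem hz.1, hD.1], hz.2⟩, Finset.subset_insert _ _⟩
    · intro x hx y hy hxy
      simp only [Finset.mem_filter, Finset.mem_univ, true_and] at hx hy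
      have : x ∈ insert y D := by rw [← hxy]; exact Finset.mem_insert_self _ _
      rcases Finset.mem_insert.1 this with h | h
      · exact h
      · exact absurd h hx.1
    · intro S hS
      simp only [Finset.bipartiteAbove, R, Finset.mem_filter, Finset.mem_univ, true_and] at hS
      obtain ⟨⟨h1, h2⟩, h4⟩ := hS
      obtain ⟨x, hx⟩ : (S \ D).Nonempty := by
        rw [← Finset.card_pos, Finset.card_sdiff_of_subset h4]; omega
      rw [Finset.mem_sdiff] at hx
      have hDe : insert x D = S := by
        apply Finset.eq_of_subset_of_card_le
        · intro z hz
          rcases Finset.mem_insert.1 hz with rfl | hz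
          · exact hx.1
          · exact h4 hz
        · rw [Finset.card_insert_of_notMem hx.2]; omega
      exact ⟨x, by simp only [Finset.mem_filter, Finset.mem_univ, true_and]; exact ⟨hx.2, by rw [hDe]; exact h2⟩, hDe⟩
  obtain ⟨y0, hy0, hy0'⟩ := door_one hk hs1 hs2 hT i0
  set D0 := (Finset.univ.erase i0).image s with hD0
  have hD0mem : D0 ∈ Ds := by
    simp only [Ds, Finset.mem_filter, Finset.mem_univ, true_and]
    refine ⟨?_, ((hy0' y0 hy0).2 rfl).mono (Finset.subset_insert _ _), ?_⟩
    · rw [hD0, Finset.card_image_of_injective _ hsinj,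
        Finset.card_erase_of_mem (Finset.mem_univ _), Finset.card_univ]; omega
    · rw [hD0, Finset.image_image]
      have : c ∘ s = id := funext hcs
      rw [this, Finset.image_id]
  have hdoor : Odd (∑ D ∈ Ds, (Finset.bipartiteAbove (fun D S => D ⊆ S) R D).card) := by
    rw [← Finset.add_sum_erase _ _ hD0mem]
    have h1 : (Finset.bipartiteAbove (fun D S => D ⊆ S) R D0).card = 1 := by
      rw [hab D0 hD0mem, Finset.card_eq_one]
      refine ⟨y0, ?_⟩
      ext z
      simp only [Finset.mem_filter, Finset.mem_univ, true_and, Finset.mem_singleton]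
      constructor
      · rintro ⟨h1, h2⟩; exact (hy0' z h1).1 h2
      · rintro rfl; exact ⟨hy0, (hy0' _ hy0).2 rfl⟩
    rw [h1]
    apply Odd.add_even odd_one
    apply Finset.even_sum
    intro D hD
    rw [Finset.mem_erase] at hD
    obtain ⟨hne, hDm⟩ := hD
    have hDm' := hDm
    simp only [Ds, Finset.mem_filter, Finset.mem_univ, true_and] at hDm'
    obtain ⟨e1, e2, e3⟩ := hDm'
    have : ∃ d ∈ D, d ∉ Set.range s := by
      by_contra hall
      push Not at hall
      apply hne
      ext x
      simp only [hD0, Finset.mem_image]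
      constructor
      · intro hx
        obtain ⟨j, rfl⟩ := hall x hx
        refine ⟨j, ?_, rfl⟩
        rw [← e3, ← hcs j]
        rw [hcs j]
        have := Finset.mem_image_of_mem c hx
        rwa [hcs] at this
      · rintro ⟨j, hj, rfl⟩
        rw [← e3] at hj
        obtain ⟨x, hx, hxj⟩ := Finset.mem_image.1 hj
        obtain ⟨j', rfl⟩ := hall x hx
        rw [hcs] at hxj
        rwa [← hxj]
    obtain ⟨d, hd, hds⟩ := this
    obtain ⟨y, y', hy, hy', hyy, hiff⟩ := door_two hk hs2 e1 e2 hd hds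
    rw [hab D hDm]
    have : (Finset.univ.filter fun z => z ∉ D ∧ Dom key (insert z D)) = {y, y'} := by
      ext z
      simp only [Finset.mem_filter, Finset.mem_univ, true_and, Finset.mem_insert,
        Finset.mem_singleton]
      constructor
      · rintro ⟨h1, h2⟩; exact (hiff z h1).1 h2
      · rintro (rfl | rfl)
        · exact ⟨hy, (hiff _ hy).2 (Or.inl rfl)⟩
        · exact ⟨hy', (hiff _ hy').2 (Or.inr rfl)⟩
    rw [this, Finset.card_pair hyy]
    exact even_two
  rw [hdc] at hdoor
  exact (Nat.not_even_iff_odd.2 hdoor) hroom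

end Scarf

end CSGame


namespace CSGame

section Brouwer

/-- Grid points of the simplex. -/
abbrev Grid (m N : ℕ) : Type := {x : Fin (m + 1) → Fin (N + 1) // ∑ i, (x i : ℕ) = N}

theorem scarf_grid (m N : ℕ) (c : Grid m N → Fin (m + 1)) :
    ∃ x0 : Grid m N, ∀ i, ((x0.1 i : ℕ) ≤ m + 1) ∨
      ∃ z : Grid m N, c z = i ∧ ∀ j, (z.1 j : ℕ) ≤ x0.1 j + (m + 1) ∧
        (x0.1 j : ℕ) ≤ z.1 j + (m + 1) := by
  classical
  let K := Fintype.card (Grid m N)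
  let e := Fintype.equivFin (Grid m N)
  let T := Grid m N ⊕ Fin (m + 1)
  let key : Fin (m + 1) → T → ℕ := fun i t => match t with
    | Sum.inl x => 1 + (x.1 i : ℕ) * K + (e x : ℕ)
    | Sum.inr j => if j = i then 0 else (N + 1) * K + 1 + (j : ℕ)
  let s : Fin (m + 1) → T := Sum.inr
  have kl : ∀ i (x : Grid m N), key i (Sum.inl x) = 1 + (x.1 i : ℕ) * K + (e x : ℕ) :=
    fun _ _ => rfl
  have ks : ∀ i, key i (s i) = 0 := fun i => if_pos rfl
  have ks' : ∀ i j, j ≠ i → key i (s j) = (N + 1) * K + 1 + (j : ℕ) := fun i j h => if_neg h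
  have hlt : ∀ (x : Grid m N) i, key i (Sum.inl x) < (N + 1) * K + 1 := by
    intro x i
    rw [kl]
    have h1 : (e x : ℕ) < K := (e x).2
    have h2 : (x.1 i : ℕ) ≤ N := Nat.lt_succ_iff.1 (x.1 i).2
    have h3 : (x.1 i : ℕ) * K ≤ N * K := Nat.mul_le_mul_right _ h2
    have h4 : (N + 1) * K = N * K + K := by ring
    omega
  have hmono : ∀ (x y : Grid m N) i, (x.1 i : ℕ) < y.1 i → key i (Sum.inl x) < key i (Sum.inl y) := by
    intro x y i h
    rw [kl, kl]
    have h1 : (e x : ℕ) < K := (e x).2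
    have h3 : ((x.1 i : ℕ) + 1) * K ≤ (y.1 i : ℕ) * K := Nat.mul_le_mul_right _ h
    have h4 : ((x.1 i : ℕ) + 1) * K = (x.1 i : ℕ) * K + K := by ring
    omega
  have hk : ∀ i, Function.Injective (key i) := by
    intro i a b hab
    rcases a with x | j <;> rcases b with y | j'
    · rcases lt_trichotomy (x.1 i : ℕ) (y.1 i) with h | h | h
      · exact absurd hab (hmono x y i h).ne
      · rw [kl, kl, h] at hab
        have : e x = e y := Fin.ext (by omega)
        rw [e.injective this]
      · exact absurd hab (hmono y x i h).ne'
    · by_cases h : j' = i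
      · subst h
        have := ks j'
        have h2 := kl j' x
        change key j' (Sum.inl x) = key j' (s j') at hab
        omega
      · have := ks' i j' h
        have h2 := hlt x i
        change key i (Sum.inl x) = key i (s j') at hab
        omega
    · by_cases h : j = i
      · subst h
        have := ks j
        have h2 := kl j y
        change key j (s j) = key j (Sum.inl y) at hab
        omega
      · have := ks' i j h
        have h2 := hlt y i
        change key i (s j) = key i (Sum.inl y) at hab
        omega
    · change key i (s j) = key i (s j') at hab
      by_cases h : j = i <;> by_cases h' : j' = i
      · rw [h, h']
      · subst h; rw [ks, ks' _ _ h'] at hab; omega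
      · subst h'; rw [ks, ks' _ _ h] at hab; omega
      · rw [ks' _ _ h, ks' _ _ h'] at hab
        have : j = j' := Fin.ext (by omega)
        rw [this]
  have hs1 : ∀ i t, t ≠ s i → key i (s i) < key i t := by
    intro i t ht
    rcases Nat.eq_zero_or_pos (key i t) with h | h
    · exact absurd (hk i (show key i t = key i (s i) by rw [h, ks])) ht
    · rw [ks]; exact h
  have hs2 : ∀ i j t, j ≠ i → t ∉ Set.range s → key i t < key i (s j) := by
    intro i j t hj ht
    rcases t with x | j'
    · rw [ks' i j hj]; have := hlt x i; omega
    · exact absurd ⟨j', rfl⟩ ht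
  have hgrid : ∀ g : Fin (m + 1) → ℕ, ∑ i, g i = N → ∃ z : Grid m N, ∀ i, (z.1 i : ℕ) = g i := by
    intro g hg
    have hle : ∀ i, g i < N + 1 := fun i => by
      have := Finset.single_le_sum (f := g) (fun j _ => Nat.zero_le _) (Finset.mem_univ i)
      omega
    exact ⟨⟨fun i => ⟨g i, hle i⟩, hg⟩, fun i => rfl⟩
  obtain ⟨t0, -⟩ := hgrid (fun i => if i = 0 then N else 0) (by simp)
  let c' : T → Fin (m + 1) := Sum.elim c id
  obtain ⟨S, hcard, hdom, hcol⟩ := scarf hk hs1 hs2 ⟨Sum.inl t0, by simp [s]⟩ c' (fun i => rfl)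
  have hns : ∀ (i : Fin (m + 1)) (x : Grid m N), (∀ y ∈ S, key i (Sum.inl x) ≤ key i y) →
      s i ∉ S := by
    intro i x h hmem
    exact absurd (hs1 i (Sum.inl x) (by simp [s])) (not_lt.2 (h _ hmem))
  have hcolor : ∀ i, s i ∉ S → ∃ z : Grid m N, Sum.inl z ∈ S ∧ c z = i := by
    intro i hi
    have : i ∈ S.image c' := by rw [hcol]; exact Finset.mem_univ _
    obtain ⟨y, hy, hyc⟩ := Finset.mem_image.1 this
    rcases y with z | j
    · exact ⟨z, hy, hyc⟩
    · change j = i at hyc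
      subst hyc
      exact absurd hy hi
  obtain ⟨i1, hi1⟩ := hdom (Sum.inl t0)
  have hi1S := hns i1 t0 hi1
  obtain ⟨x0, hx0, -⟩ := hcolor i1 hi1S
  let σ : Finset (Grid m N) := Finset.univ.filter fun x => Sum.inl x ∈ S
  have hmin : ∀ i, ∃ x : Grid m N, Sum.inl x ∈ S ∧
      ∀ y : Grid m N, Sum.inl y ∈ S → (x.1 i : ℕ) ≤ y.1 i := by
    intro i
    obtain ⟨x, hx, hx'⟩ := Finset.exists_min_image σ (fun x => (x.1 i : ℕ)) ⟨x0, by simp [σ, hx0]⟩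
    simp only [σ, Finset.mem_filter, Finset.mem_univ, true_and] at hx hx'
    exact ⟨x, hx, hx'⟩
  choose μ hμ1 hμ2 using hmin
  let C : Finset (Fin (m + 1)) := Finset.univ.filter fun i => s i ∉ S
  have hsum : N < ∑ i ∈ C, (((μ i).1 i : ℕ) + 1) := by
    by_contra hcon
    push Not at hcon
    have hi1C : i1 ∈ C := by simp [C, hi1S]
    let r := N - ∑ i ∈ C, (((μ i).1 i : ℕ) + 1)
    obtain ⟨z, hz⟩ := hgrid (fun i => (if i ∈ C then ((μ i).1 i : ℕ) + 1 else 0) +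
      (if i = i1 then r else 0)) (by
        rw [Finset.sum_add_distrib, Finset.sum_ite_mem, Finset.sum_ite_eq']
        simp only [Finset.univ_inter, Finset.mem_univ, if_true]
        omega)
    obtain ⟨i, hi⟩ := hdom (Sum.inl z)
    have hiS := hns i z hi
    have hiC : i ∈ C := by simp [C, hiS]
    have h1 := hi _ (hμ1 i)
    have h2 := hmono (μ i) z i (by rw [hz, if_pos hiC]; omega)
    omega
  have hCcard : C.card ≤ m + 1 := by
    have := Finset.card_le_univ C
    simpa using this
  rw [Finset.sum_add_distrib, Finset.sum_const, smul_eq_mul, mul_one] at hsum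
  have hupC : ∀ x : Grid m N, Sum.inl x ∈ S → ∀ i ∈ C, (x.1 i : ℕ) ≤ (μ i).1 i + (m + 1) := by
    intro x hx i hi
    have h1 := Finset.add_sum_erase C (fun i => ((μ i).1 i : ℕ)) hi
    have h2 := Finset.add_sum_erase C (fun i => (x.1 i : ℕ)) hi
    have h3 : ∑ i ∈ C.erase i, ((μ i).1 i : ℕ) ≤ ∑ i ∈ C.erase i, (x.1 i : ℕ) :=
      Finset.sum_le_sum fun j _ => hμ2 j x hx
    have h4 : ∑ i ∈ C, (x.1 i : ℕ) ≤ ∑ i, (x.1 i : ℕ) :=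
      Finset.sum_le_sum_of_subset (Finset.subset_univ _)
    rw [x.2] at h4
    omega
  have hupN : ∀ x : Grid m N, Sum.inl x ∈ S → ∀ i, i ∉ C → (x.1 i : ℕ) ≤ (m + 1) := by
    intro x hx i hi
    have h3 : ∑ i ∈ C, ((μ i).1 i : ℕ) ≤ ∑ i ∈ C, (x.1 i : ℕ) :=
      Finset.sum_le_sum fun j _ => hμ2 j x hx
    have h4 : ∑ i ∈ insert i C, (x.1 i : ℕ) ≤ ∑ i, (x.1 i : ℕ) :=
      Finset.sum_le_sum_of_subset (Finset.subset_univ _)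
    rw [x.2, Finset.sum_insert hi] at h4
    omega
  refine ⟨x0, fun i => ?_⟩
  by_cases hi : i ∈ C
  · right
    obtain ⟨z, hz, hzc⟩ := hcolor i (by simpa [C] using hi)
    refine ⟨z, hzc, fun j => ?_⟩
    by_cases hj : j ∈ C
    · have a1 := hupC z hz j hj
      have a2 := hupC x0 hx0 j hj
      have a3 := hμ2 j z hz
      have a4 := hμ2 j x0 hx0
      omega
    · have a1 := hupN z hz j hj
      have a2 := hupN x0 hx0 j hj
      omega
  · exact Or.inl (hupN x0 hx0 i hi)

theorem brouwer_approx {m : ℕ} (f : (Fin (m + 1) → ℝ) → (Fin (m + 1) → ℝ))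
    (hf : ContinuousOn f (stdSimplex ℝ (Fin (m + 1))))
    (hmaps : Set.MapsTo f (stdSimplex ℝ (Fin (m + 1))) (stdSimplex ℝ (Fin (m + 1))))
    {ε : ℝ} (hε : 0 < ε) : ∃ x ∈ stdSimplex ℝ (Fin (m + 1)), ∀ i, x i - ε ≤ f x i := by
  classical
  have huc := (isCompact_stdSimplex ℝ (Fin (m + 1))).uniformContinuousOn_of_continuous hf
  rw [Metric.uniformContinuousOn_iff] at huc
  obtain ⟨δ, hδ, huc⟩ := huc (ε / 2) (by linarith)
  obtain ⟨N, hN⟩ := exists_nat_gt (((m : ℝ) + 1) / min δ (ε / 2))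
  have hmin : 0 < min δ (ε / 2) := lt_min hδ (by linarith)
  have hNpos : (0 : ℝ) < N := lt_trans (by positivity) hN
  have hNb : ((m : ℝ) + 1) / N < min δ (ε / 2) := by
    rw [div_lt_iff₀ hNpos]; rw [div_lt_iff₀ hmin] at hN; linarith
  have hNδ := lt_of_lt_of_le hNb (min_le_left _ _)
  have hNε := lt_of_lt_of_le hNb (min_le_right _ _)
  let pt : Grid m N → (Fin (m + 1) → ℝ) := fun x i => (x.1 i : ℕ) / (N : ℝ)
  have hpt : ∀ x, pt x ∈ stdSimplex ℝ (Fin (m + 1)) := by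
    intro x
    refine ⟨fun i => by positivity, ?_⟩
    simp only [pt]
    rw [← Finset.sum_div, ← Nat.cast_sum, x.2, div_self hNpos.ne']
  have hcol : ∀ x : Grid m N, ∃ i, pt x i ≤ f (pt x) i := by
    intro x
    by_contra hcon
    push Not at hcon
    have h1 : ∑ i, f (pt x) i < ∑ i, pt x i :=
      Finset.sum_lt_sum_of_nonempty Finset.univ_nonempty fun i _ => hcon i
    rw [(hpt x).2, (hmaps (hpt x)).2] at h1
    exact lt_irrefl _ h1
  choose c hc using hcol
  obtain ⟨x0, hx0⟩ := scarf_grid m N c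
  refine ⟨pt x0, hpt x0, fun i => ?_⟩
  rcases hx0 i with h | ⟨z, hz, hzx⟩
  · have h1 : pt x0 i ≤ ((m : ℝ) + 1) / N := by
      simp only [pt]
      gcongr
      exact_mod_cast h
    have h2 := (hmaps (hpt x0)).1 i
    linarith
  · have key : ∀ j, |pt x0 j - pt z j| ≤ ((m : ℝ) + 1) / N := by
      intro j
      simp only [pt]
      rw [← sub_div, abs_div, abs_of_pos hNpos]
      gcongr
      have h1 : ((z.1 j : ℕ) : ℝ) ≤ (x0.1 j : ℕ) + (m + 1) := by exact_mod_cast (hzx j).1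
      have h2 : ((x0.1 j : ℕ) : ℝ) ≤ (z.1 j : ℕ) + (m + 1) := by exact_mod_cast (hzx j).2
      rw [abs_le]; constructor <;> linarith
    have hd : dist (pt x0) (pt z) < δ := by
      refine lt_of_le_of_lt ((dist_pi_le_iff (by positivity)).2 fun j => ?_) hNδ
      rw [Real.dist_eq]; exact key j
    have h3 := huc _ (hpt x0) _ (hpt z) hd
    have h4 : |f (pt x0) i - f (pt z) i| ≤ dist (f (pt x0)) (f (pt z)) := by
      rw [← Real.dist_eq]; exact dist_le_pi_dist _ _ i
    have h5 := hc z
    rw [hz] at h5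
    have h6 := (abs_le.1 (key i)).2
    have h7 := (abs_le.1 (h4.trans h3.le)).1
    linarith

theorem brouwer {m : ℕ} (f : (Fin (m + 1) → ℝ) → (Fin (m + 1) → ℝ))
    (hf : ContinuousOn f (stdSimplex ℝ (Fin (m + 1))))
    (hmaps : Set.MapsTo f (stdSimplex ℝ (Fin (m + 1))) (stdSimplex ℝ (Fin (m + 1)))) :
    ∃ x ∈ stdSimplex ℝ (Fin (m + 1)), f x = x := by
  have happ : ∀ k : ℕ, ∃ x ∈ stdSimplex ℝ (Fin (m + 1)), ∀ i, x i - 1 / ((k : ℝ) + 1) ≤ f x i :=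
    fun k => brouwer_approx f hf hmaps (by positivity)
  choose u hu1 hu2 using happ
  obtain ⟨x, hx, φ, hφ, hlim⟩ := (isCompact_stdSimplex ℝ (Fin (m + 1))).tendsto_subseq hu1
  have hflim : Filter.Tendsto (fun k => f (u (φ k))) Filter.atTop (nhds (f x)) := by
    have h1 : Filter.Tendsto (u ∘ φ) Filter.atTop
        (nhdsWithin x (stdSimplex ℝ (Fin (m + 1)))) :=
      tendsto_nhdsWithin_iff.2 ⟨hlim, Filter.Eventually.of_forall fun k => hu1 _⟩
    exact (hf x hx).tendsto.comp h1
  have hle : ∀ i, x i ≤ f x i := by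
    intro i
    have a1 := (tendsto_pi_nhds.1 hlim i)
    have a2 := (tendsto_pi_nhds.1 hflim i)
    have a3 : Filter.Tendsto (fun k => 1 / (((φ k : ℕ) : ℝ) + 1)) Filter.atTop (nhds 0) :=
      tendsto_one_div_add_atTop_nhds_zero_nat.comp hφ.tendsto_atTop
    have a4 := a1.sub a3
    rw [sub_zero] at a4
    exact le_of_tendsto_of_tendsto a4 a2 (Filter.Eventually.of_forall fun k => hu2 (φ k) i)
  refine ⟨x, hx, ?_⟩
  have hs : ∑ i, x i = ∑ i, f x i := by rw [hx.2, (hmaps hx).2]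
  have := (Finset.sum_eq_sum_iff_of_le fun i _ => hle i).1 hs
  funext i
  exact (this i (Finset.mem_univ i)).symm

/-- A variational inequality on the simplex. -/
theorem simplex_vi {m : ℕ} (g : (Fin (m + 1) → ℝ) → (Fin (m + 1) → ℝ))
    (hg : ContinuousOn g (stdSimplex ℝ (Fin (m + 1))))
    (h0 : ∀ t ∈ stdSimplex ℝ (Fin (m + 1)), ∑ j, t j * g t j ≤ 0) :
    ∃ t ∈ stdSimplex ℝ (Fin (m + 1)), ∀ j, g t j ≤ 0 := by
  let den : (Fin (m + 1) → ℝ) → ℝ := fun t => 1 + ∑ j, max 0 (g t j)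
  have hdpos : ∀ t, 0 < den t := fun t => by
    have : 0 ≤ ∑ j, max 0 (g t j) := Finset.sum_nonneg fun j _ => le_max_left _ _
    simp only [den]; linarith
  have hgi : ∀ j, ContinuousOn (fun t => max 0 (g t j)) (stdSimplex ℝ (Fin (m + 1))) := fun j =>
    continuousOn_const.sup ((continuous_apply j).comp_continuousOn hg)
  obtain ⟨t, ht, hfix⟩ := brouwer (fun t j => (t j + max 0 (g t j)) / den t)
    (by
      apply continuousOn_pi.2
      intro j
      apply ContinuousOn.div
      · exact (continuous_apply j).continuousOn.add (hgi j)
      · exact continuousOn_const.add (continuousOn_finsetSum _ fun j _ => hgi j)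
      · intro t _; exact (hdpos t).ne')
    (by
      intro t ht
      refine ⟨fun j => div_nonneg (add_nonneg (ht.1 j) (le_max_left _ _)) (hdpos t).le, ?_⟩
      rw [← Finset.sum_div, Finset.sum_add_distrib, ht.2]
      exact div_self (hdpos t).ne')
  refine ⟨t, ht, ?_⟩
  set P := ∑ j, max 0 (g t j) with hP
  have hfix' : ∀ j, max 0 (g t j) = t j * P := by
    intro j
    have := congrFun hfix j
    rw [div_eq_iff (hdpos t).ne'] at this
    simp only [den] at this
    linarith
  have hP0 : 0 ≤ P := Finset.sum_nonneg fun j _ => le_max_left _ _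
  rcases hP0.eq_or_lt with h | h
  · intro j
    have := hfix' j
    rw [← h, mul_zero] at this
    exact (le_max_right 0 (g t j)).trans this.le
  · exfalso
    have h1 : ∀ j, t j * g t j = t j * (t j * P) := by
      intro j
      rcases (ht.1 j).eq_or_lt with hj | hj
      · rw [← hj]; simp
      · have := hfix' j
        have hpos : 0 < t j * P := mul_pos hj h
        rcases max_choice 0 (g t j) with hm | hm
        · rw [hm] at this; linarith
        · rw [hm] at this; rw [this]
    have h2 := h0 t ht
    simp_rw [h1] at h2
    have hex : ∃ j, 0 < t j := by
      by_contra hcon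
      push Not at hcon
      have : ∑ j, t j ≤ 0 := Finset.sum_nonpos fun j _ => hcon j
      rw [ht.2] at this
      linarith
    obtain ⟨j, hj⟩ := hex
    have : 0 < ∑ j, t j * (t j * P) :=
      Finset.sum_pos' (fun i _ => mul_nonneg (ht.1 i) (mul_nonneg (ht.1 i) hP0))
        ⟨j, Finset.mem_univ _, mul_pos hj (mul_pos hj h)⟩
    linarith

/-- Ky Fan's inequality in an abstract convex compact space. -/
theorem kyFan {K : Type*} [TopologicalSpace K] [CompactSpace K] [Nonempty K]
    (f : K → K → ℝ) (hcont : ∀ y, Continuous fun z => f z y) (hdiag : ∀ z, f z z ≤ 0)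
    (hconv : ∀ (m : ℕ) (y : Fin (m + 1) → K), ∃ σ : (Fin (m + 1) → ℝ) → K,
      ContinuousOn σ (stdSimplex ℝ (Fin (m + 1))) ∧
      ∀ t ∈ stdSimplex ℝ (Fin (m + 1)), ∀ z, f z (σ t) = ∑ j, t j * f z (y j)) :
    ∃ z, ∀ y, f z y ≤ 0 := by
  have hne : (⋂ y, {z | f z y ≤ 0}).Nonempty := by
    by_contra hemp
    rw [Set.not_nonempty_iff_eq_empty] at hemp
    obtain ⟨F, hF⟩ := isCompact_univ.elim_finite_subfamily_closed
      (fun y => {z | f z y ≤ 0}) (fun y => isClosed_le (hcont y) continuous_const)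
      (by rw [hemp, Set.inter_empty])
    rw [Set.univ_inter] at hF
    have hFne : F.Nonempty := by
      by_contra h
      rw [Finset.not_nonempty_iff_eq_empty] at h
      subst h
      simp at hF
    obtain ⟨m, hm⟩ : ∃ m, F.card = m + 1 := Nat.exists_eq_succ_of_ne_zero (Finset.card_ne_zero.2 hFne)
    let y : Fin (m + 1) → K := fun j => (F.equivFinOfCardEq hm).symm j
    obtain ⟨σ, hσ, hσf⟩ := hconv m y
    obtain ⟨t, ht, hle⟩ := simplex_vi (fun t j => f (σ t) (y j))
      (continuousOn_pi.2 fun j => (hcont (y j)).comp_continuousOn hσ)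
      (fun t ht => by rw [← hσf t ht]; exact hdiag _)
    have : σ t ∈ ⋂ i ∈ F, {z | f z i ≤ 0} := by
      simp only [Set.mem_iInter]
      intro i hi
      have := hle (F.equivFinOfCardEq hm ⟨i, hi⟩)
      simpa [y] using this
    rw [hF] at this
    exact this
  obtain ⟨z, hz⟩ := hne
  exact ⟨z, fun y => Set.mem_iInter.1 hz y⟩

end Brouwer

end CSGame

open MeasureTheory ProbabilityTheory Filter Topology
open scoped ENNReal NNReal
namespace CSGame
section MeasurePart
set_option linter.unusedSectionVars false
variable {n l : ℕ}
variable {X : Type} [Countable X] [MeasurableSpace X] [DiscreteMeasurableSpace X]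
  [TopologicalSpace X] [DiscreteTopology X] [BorelSpace X] [SecondCountableTopology X]
variable {A : Fin n → Type} [∀ i, MeasurableSpace (A i)] [∀ i, TopologicalSpace (A i)]
  [∀ i, PolishSpace (A i)] [∀ i, BorelSpace (A i)]
variable (G : GameData n l X A)

theorem measurable_p (x : X) : Measurable (G.p x) := by
  refine Measure.measurable_of_measurable_coe _ fun s _ => ?_
  have : (fun a => G.p x a s) = fun a => ∑' y : s, G.p x a {(y : X)} := by
    funext a
    rw [← measure_biUnion (Set.to_countable s)]
    · simp
    · intro y _ z _ hyz
      simpa using hyz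
    · intro y _; exact measurableSet_singleton y
  rw [this]
  exact Measurable.tsum fun y => G.hpm x y

theorem measurableSet_jointSet (x : X) : MeasurableSet (jointSet G x) :=
  MeasurableSet.univ_pi fun i => (G.hAs_cpt i x).isClosed.measurableSet

/-- A probability measure on action profiles carried by the feasible ones. -/
structure Good (x : X) (m : Measure (JA A)) : Prop where
  prob : IsProbabilityMeasure m
  supp : ∀ᵐ a ∂m, a ∈ jointSet G x

/-- The law of the next state. -/
noncomputable def nxt (x : X) (m : Measure (JA A)) : Measure X := m.bind (G.p x)

theorem good_pi (x : X) (q : ∀ i, ProbabilityMeasure (A i)) (h : ∀ i, q i (G.As i x) = 1) :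
    Good G x (Measure.pi fun i => (q i : Measure (A i))) := by
  have hp : IsProbabilityMeasure (Measure.pi fun i => (q i : Measure (A i))) := inferInstance
  refine ⟨hp, ?_⟩
  have : (Measure.pi fun i => (q i : Measure (A i))) (jointSet G x) = 1 := by
    rw [jointSet, Measure.pi_pi]
    refine Finset.prod_eq_one fun i _ => ?_
    have := h i
    rw [← ENNReal.coe_inj, ProbabilityMeasure.ennreal_coeFn_eq_coeFn_toMeasure] at this
    simpa using this
  exact (prob_compl_eq_zero_iff (measurableSet_jointSet G x)).2 this

theorem good_jointLaw (π : MultiStrategy G) (t : ℕ) (h : Hist X (JA A) t) :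
    Good G (lastState X (JA A) t h) (jointLaw G π t h) :=
  good_pi G _ _ fun i => (π i).supp t h

theorem measurable_jointLaw (π : MultiStrategy G) (t : ℕ) : Measurable (jointLaw G π t) := by
  have : ∀ h, IsProbabilityMeasure (jointLaw G π t h) := fun h => (good_jointLaw G π t h).prob
  refine Measurable.measure_of_isPiSystem_of_isProbabilityMeasure
    (S := Set.pi Set.univ '' Set.pi Set.univ fun i => {s : Set (A i) | MeasurableSet s})
    generateFrom_pi.symm isPiSystem_pi ?_
  rintro _ ⟨s, hs, rfl⟩
  simp only [jointLaw, Measure.pi_pi]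
  exact Finset.measurable_prod _ fun i _ => (π i).meas t (s i) (hs i trivial)

theorem isProb_nxt {x : X} {m : Measure (JA A)} (hm : Good G x m) :
    IsProbabilityMeasure (nxt G x m) := by
  have := hm.prob
  have := G.hp
  exact isProbabilityMeasure_bind (measurable_p G x).aemeasurable (ae_of_all _ fun a => this x a)

theorem lintegral_nxt (x : X) (m : Measure (JA A)) (g : X → ℝ≥0∞) :
    ∫⁻ y, g y ∂nxt G x m = ∫⁻ a, ∫⁻ y, g y ∂G.p x a ∂m :=
  Measure.lintegral_bind (measurable_p G x).aemeasurable (Measurable.of_discrete).aemeasurable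

/-- stage transition measure on histories -/
noncomputable def stepM (π : MultiStrategy G) (t : ℕ) (h : Hist X (JA A) t) :
    Measure (Hist X (JA A) (t + 1)) :=
  (jointLaw G π t h).bind fun a =>
          (G.p (lastState X (JA A) t h) a).map fun y =>
            (show Hist X (JA A) (t + 1) from (h, a, y))

theorem measurable_pair (t : ℕ) (h : Hist X (JA A) t) (a : JA A) :
    Measurable fun y : X => (show Hist X (JA A) (t + 1) from (h, a, y)) :=
  Measurable.of_discrete

/-- the transition kernel on pairs (history, action) -/
noncomputable def pKer (t : ℕ) : Kernel (Hist X (JA A) t × JA A) X where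
  toFun q := G.p (lastState X (JA A) t q.1) q.2
  measurable' := by
    have h1 : Measurable fun q : X × JA A => G.p q.1 q.2 :=
      measurable_from_prod_countable_right fun x => measurable_p G x
    exact h1.comp (((measurable_lastState X (JA A) t).comp measurable_fst).prodMk measurable_snd)

instance (t : ℕ) : IsMarkovKernel (pKer G t) := ⟨fun _ => G.hp _ _⟩

theorem stepM_inner (t : ℕ) (h : Hist X (JA A) t) :
    Measurable fun a => (G.p (lastState X (JA A) t h) a).map fun y =>
            (show Hist X (JA A) (t + 1) from (h, a, y)) := by
  refine Measure.measurable_of_measurable_coe _ fun s hs => ?_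
  have hs' : MeasurableSet {q : (Hist X (JA A) t × JA A) × X |
      (show Hist X (JA A) (t + 1) from (q.1.1, q.1.2, q.2)) ∈ s} := by
    have : Measurable fun q : (Hist X (JA A) t × JA A) × X =>
      (show Hist X (JA A) (t + 1) from (q.1.1, q.1.2, q.2)) :=
      MeasurableEquiv.prodAssoc.measurable
    exact this hs
  have h3 := (Kernel.measurable_kernel_prodMk_left (κ := pKer G t) hs').comp
    (measurable_prodMk_left (x := h))
  convert h3 using 1
  funext a
  rw [Measure.map_apply (measurable_pair t h a) hs]
  rfl

theorem stepM_apply (π : MultiStrategy G) (t : ℕ) (h : Hist X (JA A) t)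
    {s : Set (Hist X (JA A) (t + 1))} (hs : MeasurableSet s) :
    stepM G π t h s = ∫⁻ a, (G.p (lastState X (JA A) t h) a)
      {y | (show Hist X (JA A) (t + 1) from (h, a, y)) ∈ s} ∂jointLaw G π t h := by
  rw [stepM, Measure.bind_apply hs (stepM_inner G t h).aemeasurable]
  refine lintegral_congr fun a => ?_
  rw [Measure.map_apply (measurable_pair t h a) hs]
  rfl

theorem measurable_stepM (π : MultiStrategy G) (t : ℕ) : Measurable (stepM G π t) := by
  refine Measure.measurable_of_measurable_coe _ fun s hs => ?_
  simp only [stepM_apply G π t _ hs]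
  have hs' : MeasurableSet {q : (Hist X (JA A) t × JA A) × X |
      (show Hist X (JA A) (t + 1) from (q.1.1, q.1.2, q.2)) ∈ s} := by
    have : Measurable fun q : (Hist X (JA A) t × JA A) × X =>
      (show Hist X (JA A) (t + 1) from (q.1.1, q.1.2, q.2)) :=
      MeasurableEquiv.prodAssoc.measurable
    exact this hs
  have h3 := (Kernel.measurable_kernel_prodMk_left (κ := pKer G t) hs')
  let K : Kernel (Hist X (JA A) t) (JA A) := ⟨jointLaw G π t, measurable_jointLaw G π t⟩
  have : IsMarkovKernel K := ⟨fun h => (good_jointLaw G π t h).prob⟩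
  exact h3.lintegral_kernel_prod_right' (κ := K)

theorem isProb_stepM (π : MultiStrategy G) (t : ℕ) (h : Hist X (JA A) t) :
    IsProbabilityMeasure (stepM G π t h) := by
  have := (good_jointLaw G π t h).prob
  refine isProbabilityMeasure_bind (stepM_inner G t h).aemeasurable (ae_of_all _ fun a => ?_)
  have := G.hp (lastState X (JA A) t h) a
  exact Measure.isProbabilityMeasure_map (measurable_pair t h a).aemeasurable

theorem isProb_hist (π : MultiStrategy G) (t : ℕ) : IsProbabilityMeasure (histMeas G G.η π t) := by
  induction t with
  | zero => exact G.hη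
  | succ t ih =>
    exact isProbabilityMeasure_bind (measurable_stepM G π t).aemeasurable
      (ae_of_all _ fun h => isProb_stepM G π t h)

theorem map_stepM (π : MultiStrategy G) (t : ℕ) (h : Hist X (JA A) t) :
    (stepM G π t h).map (lastState X (JA A) (t + 1)) =
      nxt G (lastState X (JA A) t h) (jointLaw G π t h) := by
  ext s hs
  rw [Measure.map_apply (measurable_lastState _ _ _) hs,
    stepM_apply G π t h (measurable_lastState _ _ _ hs), nxt,
    Measure.bind_apply hs (measurable_p G _).aemeasurable]
  rfl

theorem measurable_nxt (π : MultiStrategy G) (t : ℕ) :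
    Measurable fun h => nxt G (lastState X (JA A) t h) (jointLaw G π t h) := by
  simp only [← map_stepM]
  exact (Measure.measurable_map _ (measurable_lastState _ _ _)).comp (measurable_stepM G π t)

/-- The law of the `t`-th state. -/
noncomputable def stLaw (π : MultiStrategy G) (t : ℕ) : Measure X :=
  (histMeas G G.η π t).map (lastState X (JA A) t)

theorem stLaw_succ (π : MultiStrategy G) (t : ℕ) :
    stLaw G π (t + 1) = (histMeas G G.η π t).bind
      fun h => nxt G (lastState X (JA A) t h) (jointLaw G π t h) := by
  ext s hs
  rw [stLaw, Measure.map_apply (measurable_lastState _ _ _) hs,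
    Measure.bind_apply hs (measurable_nxt G π t).aemeasurable]
  change ((histMeas G G.η π t).bind (stepM G π t)) _ = _
  rw [Measure.bind_apply (measurable_lastState _ _ _ hs) (measurable_stepM G π t).aemeasurable]
  refine lintegral_congr fun h => ?_
  rw [← map_stepM, Measure.map_apply (measurable_lastState _ _ _) hs]

theorem stLaw_zero (π : MultiStrategy G) : stLaw G π 0 = G.η := Measure.map_id

/-- Weight growth along one step. -/
def Wgt (w : X → ℝ) (δ : ℝ) : Prop := (∀ x, 1 ≤ w x) ∧ 1 ≤ δ ∧ δ * G.α < 1 ∧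
  (∀ x a, a ∈ jointSet G x → ∫⁻ y, ENNReal.ofReal (w y) ∂(G.p x a) ≤ ENNReal.ofReal (δ * w x)) ∧
  (∫⁻ y, ENNReal.ofReal (w y) ∂G.η) < ⊤

variable {w : X → ℝ} {δ : ℝ}

theorem lint_nxt_le (hw : Wgt G w δ) {x : X} {m : Measure (JA A)} (hm : Good G x m) :
    ∫⁻ y, ENNReal.ofReal (w y) ∂nxt G x m ≤ ENNReal.ofReal (δ * w x) := by
  rw [lintegral_nxt]
  have := hm.prob
  calc _ ≤ ∫⁻ a, ENNReal.ofReal (δ * w x) ∂m :=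
        lintegral_mono_ae (hm.supp.mono fun a ha => hw.2.2.2.1 x a ha)
    _ = _ := by simp

theorem intgble {m : Measure X} (hm : ∫⁻ y, ENNReal.ofReal (w y) ∂m < ⊤) (hw : ∀ x, 1 ≤ w x)
    {v : X → ℝ} {C : ℝ} (hv : ∀ x, |v x| ≤ C * w x) : Integrable v m := by
  have hwi : Integrable w m := by
    refine ⟨Measurable.of_discrete.aestronglyMeasurable, ?_⟩
    rw [hasFiniteIntegral_iff_ofReal (ae_of_all _ fun x => (zero_le_one.trans (hw x)))]
    exact hm
  exact (hwi.const_mul C).mono' Measurable.of_discrete.aestronglyMeasurable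
    (ae_of_all _ fun x => by simpa using hv x)

theorem int_nxt_le (hw : Wgt G w δ) {x : X} {m : Measure (JA A)} (hm : Good G x m) :
    ∫ y, w y ∂nxt G x m ≤ δ * w x := by
  have h0 : ∀ x, 0 ≤ w x := fun x => zero_le_one.trans (hw.1 x)
  have hd : 0 ≤ δ := zero_le_one.trans hw.2.1
  rw [integral_eq_lintegral_of_nonneg_ae (ae_of_all _ h0)
    Measurable.of_discrete.aestronglyMeasurable]
  exact ENNReal.toReal_le_of_le_ofReal (mul_nonneg hd (h0 x)) (lint_nxt_le G hw hm)

theorem intgble_nxt (hw : Wgt G w δ) {x : X} {m : Measure (JA A)} (hm : Good G x m)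
    {v : X → ℝ} {C : ℝ} (hv : ∀ x, |v x| ≤ C * w x) : Integrable v (nxt G x m) :=
  intgble ((lint_nxt_le G hw hm).trans_lt ENNReal.ofReal_lt_top) hw.1 hv

theorem abs_int_nxt_le (hw : Wgt G w δ) {x : X} {m : Measure (JA A)} (hm : Good G x m)
    {v : X → ℝ} {C : ℝ} (hC : 0 ≤ C) (hv : ∀ x, |v x| ≤ C * w x) :
    |∫ y, v y ∂nxt G x m| ≤ C * (δ * w x) := by
  have hi := intgble_nxt G hw hm hv
  have hwi : Integrable w (nxt G x m) := intgble_nxt G hw hm (C := 1) (v := w) fun x => by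
    rw [abs_of_nonneg (zero_le_one.trans (hw.1 x))]; simp
  calc |∫ y, v y ∂nxt G x m| ≤ ∫ y, |v y| ∂nxt G x m := abs_integral_le_integral_abs
    _ ≤ ∫ y, C * w y ∂nxt G x m := integral_mono hi.abs (hwi.const_mul C) hv
    _ = C * ∫ y, w y ∂nxt G x m := integral_const_mul _ _
    _ ≤ _ := mul_le_mul_of_nonneg_left (int_nxt_le G hw hm) hC

theorem lint_stLaw (hw : Wgt G w δ) (π : MultiStrategy G) (t : ℕ) :
    ∫⁻ y, ENNReal.ofReal (w y) ∂stLaw G π t ≤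
      ENNReal.ofReal δ ^ t * ∫⁻ y, ENNReal.ofReal (w y) ∂G.η := by
  have hd : 0 ≤ δ := zero_le_one.trans hw.2.1
  induction t with
  | zero => simp [stLaw_zero]
  | succ t ih =>
    rw [stLaw_succ, Measure.lintegral_bind (measurable_nxt G π t).aemeasurable
      Measurable.of_discrete.aemeasurable]
    calc _ ≤ ∫⁻ h, ENNReal.ofReal δ * ENNReal.ofReal (w (lastState X (JA A) t h))
              ∂histMeas G G.η π t := by
            refine lintegral_mono fun h => ?_
            rw [← ENNReal.ofReal_mul hd]
            exact lint_nxt_le G hw (good_jointLaw G π t h)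
      _ = ENNReal.ofReal δ * ∫⁻ y, ENNReal.ofReal (w y) ∂stLaw G π t := by
            rw [lintegral_const_mul' _ _ ENNReal.ofReal_ne_top, stLaw,
              lintegral_map Measurable.of_discrete (measurable_lastState _ _ _)]
      _ ≤ _ := by
            rw [pow_succ', mul_assoc]
            gcongr

theorem int_stLaw (hw : Wgt G w δ) (π : MultiStrategy G) (t : ℕ) :
    ∫ y, w y ∂stLaw G π t ≤ δ ^ t * ∫ y, w y ∂G.η := by
  have h0 : ∀ x, 0 ≤ w x := fun x => zero_le_one.trans (hw.1 x)
  have hd : 0 ≤ δ := zero_le_one.trans hw.2.1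
  rw [integral_eq_lintegral_of_nonneg_ae (ae_of_all _ h0)
    Measurable.of_discrete.aestronglyMeasurable, integral_eq_lintegral_of_nonneg_ae (ae_of_all _ h0)
    Measurable.of_discrete.aestronglyMeasurable]
  have := ENNReal.toReal_mono (ENNReal.mul_ne_top (ENNReal.pow_ne_top ENNReal.ofReal_ne_top)
    hw.2.2.2.2.ne) (lint_stLaw G hw π t)
  simpa [ENNReal.toReal_ofReal hd] using this

theorem intgble_stLaw (hw : Wgt G w δ) (π : MultiStrategy G) (t : ℕ)
    {v : X → ℝ} {C : ℝ} (hv : ∀ x, |v x| ≤ C * w x) : Integrable v (stLaw G π t) :=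
  intgble ((lint_stLaw G hw π t).trans_lt (ENNReal.mul_lt_top
    (ENNReal.pow_lt_top ENNReal.ofReal_lt_top) hw.2.2.2.2)) hw.1 hv

theorem intgble_hist (hw : Wgt G w δ) (π : MultiStrategy G) (t : ℕ)
    {v : X → ℝ} {C : ℝ} (hv : ∀ x, |v x| ≤ C * w x) :
    Integrable (fun h => v (lastState X (JA A) t h)) (histMeas G G.η π t) :=
  (integrable_map_measure Measurable.of_discrete.aestronglyMeasurable
    (measurable_lastState _ _ _).aemeasurable).1 (intgble_stLaw G hw π t hv)

theorem int_hist (π : MultiStrategy G) (t : ℕ) (v : X → ℝ) :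
    ∫ h, v (lastState X (JA A) t h) ∂(histMeas G G.η π t) = ∫ y, v y ∂stLaw G π t :=
  (integral_map (measurable_lastState _ _ _).aemeasurable
    Measurable.of_discrete.aestronglyMeasurable).symm

end MeasurePart
end CSGame

open MeasureTheory ProbabilityTheory Filter Topology
open scoped ENNReal NNReal
namespace CSGame
section Verif
set_option linter.unusedSectionVars false
variable {n l : ℕ}
variable {X : Type} [Countable X] [MeasurableSpace X] [DiscreteMeasurableSpace X]
  [TopologicalSpace X] [DiscreteTopology X] [BorelSpace X] [SecondCountableTopology X]
variable {A : Fin n → Type} [∀ i, MeasurableSpace (A i)] [∀ i, TopologicalSpace (A i)]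
  [∀ i, PolishSpace (A i)] [∀ i, BorelSpace (A i)]
variable (G : GameData n l X A)
variable {w : X → ℝ} {δ : ℝ}

/-- A measurable cost function dominated by the weight. -/
def CostOK (w : X → ℝ) (c : X → JA A → ℝ) : Prop :=
  (∀ x, Measurable (c x)) ∧ ∀ x a, a ∈ jointSet G x → |c x a| ≤ w x

/-- One-step cost with continuation value `v`. -/
noncomputable def oneStep (c : X → JA A → ℝ) (v : X → ℝ) (x : X) (m : Measure (JA A)) : ℝ :=
  (1 - G.α) * ∫ a, c x a ∂m + G.α * ∫ y, v y ∂nxt G x m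

variable {c : X → JA A → ℝ}

theorem abs_int_c_le (hc : CostOK G w c) {x : X} {m : Measure (JA A)} (hm : Good G x m) :
    |∫ a, c x a ∂m| ≤ w x := by
  have := hm.prob
  have h := norm_integral_le_of_norm_le_const (μ := m) (f := c x) (C := w x)
    (hm.supp.mono fun a ha => hc.2 x a ha)
  simpa using h

theorem measurable_int_c (hc : CostOK G w c) (π : MultiStrategy G) (t : ℕ) :
    Measurable fun h => ∫ a, c (lastState X (JA A) t h) a ∂jointLaw G π t h := by
  let K : Kernel (Hist X (JA A) t) (JA A) := ⟨jointLaw G π t, measurable_jointLaw G π t⟩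
  have : IsMarkovKernel K := ⟨fun h => (good_jointLaw G π t h).prob⟩
  have h1 : Measurable fun q : X × JA A => c q.1 q.2 :=
    measurable_from_prod_countable_right fun x => hc.1 x
  have h2 : Measurable fun q : Hist X (JA A) t × JA A => c (lastState X (JA A) t q.1) q.2 :=
    h1.comp (((measurable_lastState X (JA A) t).comp measurable_fst).prodMk measurable_snd)
  exact (h2.stronglyMeasurable.integral_kernel_prod_right' (κ := K)).measurable

theorem measurable_int_v (v : X → ℝ) (π : MultiStrategy G) (t : ℕ) :
    Measurable fun h => ∫ y, v y ∂nxt G (lastState X (JA A) t h) (jointLaw G π t h) := by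
  let K : Kernel (Hist X (JA A) t) X := ⟨_, measurable_nxt G π t⟩
  have : IsMarkovKernel K := ⟨fun h => isProb_nxt G (good_jointLaw G π t h)⟩
  have h2 : Measurable fun q : Hist X (JA A) t × X => v q.2 :=
    (Measurable.of_discrete (f := v)).comp measurable_snd
  exact (h2.stronglyMeasurable.integral_kernel_prod_right' (κ := K)).measurable

theorem w_bound (hw : Wgt G w δ) : ∀ x, |w x| ≤ 1 * w x := fun x => by
  rw [abs_of_nonneg (zero_le_one.trans (hw.1 x))]; simp

theorem intgble_stage (hw : Wgt G w δ) (hc : CostOK G w c) (π : MultiStrategy G) (t : ℕ) :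
    Integrable (fun h => ∫ a, c (lastState X (JA A) t h) a ∂jointLaw G π t h)
      (histMeas G G.η π t) :=
  (intgble_hist G hw π t (v := w) (C := 1) (w_bound G hw)).mono'
    (measurable_int_c G hc π t).aestronglyMeasurable
    (ae_of_all _ fun h => abs_int_c_le G hc (good_jointLaw G π t h))

theorem intgble_cont (hw : Wgt G w δ) {v : X → ℝ} {C : ℝ} (hC : 0 ≤ C)
    (hv : ∀ x, |v x| ≤ C * w x) (π : MultiStrategy G) (t : ℕ) :
    Integrable (fun h => ∫ y, v y ∂nxt G (lastState X (JA A) t h) (jointLaw G π t h))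
      (histMeas G G.η π t) := by
  refine ((intgble_hist G hw π t (v := w) (C := 1) (w_bound G hw)).const_mul (C * δ)).mono'
    (measurable_int_v G v π t).aestronglyMeasurable
    (ae_of_all _ fun h => ?_)
  have := abs_int_nxt_le G hw (good_jointLaw G π t h) hC hv
  rwa [← mul_assoc] at this

theorem integral_bindK {α β : Type*} [MeasurableSpace α] [MeasurableSpace β] (m : Measure α)
    [SFinite m] (κ : α → Measure β) (hκ : Measurable κ) (hp : ∀ a, IsProbabilityMeasure (κ a))
    {f : β → ℝ} (hf : Integrable f (m.bind κ)) :
    ∫ y, f y ∂m.bind κ = ∫ a, ∫ y, f y ∂κ a ∂m := by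
  let K : Kernel α β := ⟨κ, hκ⟩
  have : IsMarkovKernel K := ⟨hp⟩
  have e : m.bind κ = (K ∘ₖ Kernel.const Unit m) () := by
    rw [Kernel.comp_apply]; rfl
  rw [e] at hf ⊢
  rw [Kernel.integral_comp hf]
  rfl

theorem int_cont (hw : Wgt G w δ) {v : X → ℝ} {C : ℝ}
    (hv : ∀ x, |v x| ≤ C * w x) (π : MultiStrategy G) (t : ℕ) :
    ∫ h, ∫ y, v y ∂nxt G (lastState X (JA A) t h) (jointLaw G π t h) ∂histMeas G G.η π t =
      ∫ y, v y ∂stLaw G π (t + 1) := by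
  have hi := intgble_stLaw G hw π (t + 1) hv
  have := isProb_hist G π t
  rw [stLaw_succ] at hi ⊢
  exact (integral_bindK _ _ (measurable_nxt G π t)
    (fun h => isProb_nxt G (good_jointLaw G π t h)) hi).symm

theorem abs_stageExp_le (hw : Wgt G w δ) (hc : CostOK G w c) (π : MultiStrategy G) (t : ℕ) :
    |stageExp G G.η π t c| ≤ δ ^ t * ∫ y, w y ∂G.η := by
  refine le_trans ?_ (int_stLaw G hw π t)
  rw [← int_hist]
  refine abs_integral_le_integral_abs.trans (integral_mono (intgble_stage G hw hc π t).abs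
    (intgble_hist G hw π t (C := 1) (w_bound G hw)) fun h => ?_)
  exact abs_int_c_le G hc (good_jointLaw G π t h)

theorem abs_int_stLaw_le (hw : Wgt G w δ) {v : X → ℝ} {C : ℝ} (hC : 0 ≤ C)
    (hv : ∀ x, |v x| ≤ C * w x) (π : MultiStrategy G) (t : ℕ) :
    |∫ y, v y ∂stLaw G π t| ≤ C * (δ ^ t * ∫ y, w y ∂G.η) := by
  refine le_trans ?_ (mul_le_mul_of_nonneg_left (int_stLaw G hw π t) hC)
  rw [← integral_const_mul]
  exact abs_integral_le_integral_abs.trans (integral_mono (intgble_stLaw G hw π t hv).abs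
    ((intgble_stLaw G hw π t (C := 1) (w_bound G hw)).const_mul C) hv)

theorem summable_geo (hw : Wgt G w δ) {a : ℕ → ℝ} {C : ℝ} (ha : ∀ t, |a t| ≤ C * δ ^ t) :
    Summable fun t => G.α ^ t * a t := by
  have hα := G.hα0
  have hd : 0 ≤ δ := zero_le_one.trans hw.2.1
  refine Summable.of_norm_bounded (g := fun t => C * (δ * G.α) ^ t)
    ((summable_geometric_of_lt_one (by positivity) hw.2.2.1).mul_left C) fun t => ?_
  rw [Real.norm_eq_abs, abs_mul, abs_of_nonneg (by positivity : 0 ≤ G.α ^ t), mul_pow]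
  calc G.α ^ t * |a t| ≤ G.α ^ t * (C * δ ^ t) := by gcongr; exact ha t
    _ = _ := by ring

/-- integrability of the one-step gap -/
theorem intgble_gap (hw : Wgt G w δ) (hc : CostOK G w c) {v : X → ℝ} {C : ℝ} (hC : 0 ≤ C)
    (hv : ∀ x, |v x| ≤ C * w x) (π : MultiStrategy G) (t : ℕ) :
    Integrable (fun h => oneStep G c v (lastState X (JA A) t h) (jointLaw G π t h)
      - v (lastState X (JA A) t h)) (histMeas G G.η π t) :=
  (((intgble_stage G hw hc π t).const_mul _).add
    ((intgble_cont G hw hC hv π t).const_mul _)).sub (intgble_hist G hw π t hv)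

theorem verif (hw : Wgt G w δ) (hc : CostOK G w c) {v : X → ℝ} {C : ℝ} (hC : 0 ≤ C)
    (hv : ∀ x, |v x| ≤ C * w x) (π : MultiStrategy G) :
    HasSum (fun t => G.α ^ t * ∫ h, (oneStep G c v (lastState X (JA A) t h) (jointLaw G π t h)
      - v (lastState X (JA A) t h)) ∂(histMeas G G.η π t))
      (Jfun G G.η c π - ∫ y, v y ∂G.η) := by
  set s : ℕ → ℝ := fun t => ∫ y, v y ∂stLaw G π t with hs
  have key : ∀ t, ∫ h, (oneStep G c v (lastState X (JA A) t h) (jointLaw G π t h)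
      - v (lastState X (JA A) t h)) ∂(histMeas G G.η π t) =
      (1 - G.α) * stageExp G G.η π t c + G.α * s (t + 1) - s t := by
    intro t
    have i1 := (intgble_stage G hw hc π t).const_mul (1 - G.α)
    have i2 := (intgble_cont G hw hC hv π t).const_mul G.α
    have i3 := intgble_hist G hw π t hv
    simp only [oneStep]
    have i12 : Integrable (fun h => (1 - G.α) * ∫ a, c (lastState X (JA A) t h) a ∂jointLaw G π t h
      + G.α * ∫ y, v y ∂nxt G (lastState X (JA A) t h) (jointLaw G π t h))
      (histMeas G G.η π t) := i1.add i2
    rw [integral_sub i12 i3, integral_add i1 i2, integral_const_mul, integral_const_mul,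
      int_cont G hw hv, int_hist]
    rfl
  simp only [key]
  have S1 : Summable fun t => G.α ^ t * stageExp G G.η π t c :=
    summable_geo G hw (C := ∫ y, w y ∂G.η) fun t => by
      rw [mul_comm]; exact abs_stageExp_le G hw hc π t
  have S2 : Summable fun t => G.α ^ t * s t :=
    summable_geo G hw (C := C * ∫ y, w y ∂G.η) fun t => by
      have := abs_int_stLaw_le G hw hC hv π t
      rw [mul_assoc, mul_comm (∫ y, w y ∂G.η)]; exact this
  have S3 := (hasSum_nat_add_iff' 1).2 S2.hasSum
  have := (S1.hasSum.mul_left (1 - G.α)).add (S3.sub S2.hasSum)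
  have e0 : s 0 = ∫ y, v y ∂G.η := by simp only [hs, stLaw_zero]
  have e1 : (fun t => G.α ^ t * ((1 - G.α) * stageExp G G.η π t c + G.α * s (t + 1) - s t)) =
      fun b => (1 - G.α) * (G.α ^ b * stageExp G G.η π b c) +
        (G.α ^ (b + 1) * s (b + 1) - G.α ^ b * s b) := by
    funext t; simp only [pow_succ]; ring
  rw [e1]
  have e2 : Jfun G G.η c π - ∫ y, v y ∂G.η = (1 - G.α) * ∑' (b : ℕ), G.α ^ b * stageExp G G.η π b c +
      (∑' (b : ℕ), G.α ^ b * s b - ∑ i ∈ Finset.range 1, G.α ^ i * s i - ∑' (b : ℕ), G.α ^ b * s b) := by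
    simp [Jfun, e0, sub_eq_add_neg]
  rw [e2]; exact this

end Verif
end CSGame

open MeasureTheory ProbabilityTheory Filter Topology
open scoped ENNReal NNReal
namespace CSGame
section Values
set_option linter.unusedSectionVars false
variable {n l : ℕ}
variable {X : Type} [Countable X] [MeasurableSpace X] [DiscreteMeasurableSpace X]
  [TopologicalSpace X] [DiscreteTopology X] [BorelSpace X] [SecondCountableTopology X]
variable {A : Fin n → Type} [∀ i, MeasurableSpace (A i)] [∀ i, TopologicalSpace (A i)]
  [∀ i, PolishSpace (A i)] [∀ i, BorelSpace (A i)]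
variable (G : GameData n l X A)
variable {w : X → ℝ} {δ : ℝ} {c : X → JA A → ℝ}

/-- The action distribution of a stationary strategy at a state. -/
noncomputable def stAt {i : Fin n} (θ : Stat G i) (x : X) : ProbabilityMeasure (A i) := θ.1 x

theorem stAt_supp {i : Fin n} (θ : Stat G i) (x : X) : stAt G θ x (G.As i x) = 1 := θ.2 x

/-- Build a stationary strategy. -/
noncomputable def mkStat {i : Fin n} (q : X → ProbabilityMeasure (A i))
    (hq : ∀ x, q x (G.As i x) = 1) : Stat G i := ⟨q, hq⟩

theorem stAt_mkStat {i : Fin n} (q : X → ProbabilityMeasure (A i))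
    (hq : ∀ x, q x (G.As i x) = 1) (x : X) : stAt G (mkStat G q hq) x = q x := rfl

/-- The joint action law of a stationary profile. -/
noncomputable def law (φ : StatProfile G) (x : X) : Measure (JA A) :=
  Measure.pi fun j => (stAt G (φ j) x : Measure (A j))

theorem good_law (φ : StatProfile G) (x : X) : Good G x (law G φ x) :=
  good_pi G x _ fun j => stAt_supp G (φ j) x

/-- Expected cost at stage `t` from state `x`. -/
noncomputable def uu (c : X → JA A → ℝ) (φ : StatProfile G) : ℕ → X → ℝ
  | 0 => fun x => ∫ a, c x a ∂law G φ x
  | t + 1 => fun x => ∫ y, uu c φ t y ∂nxt G x (law G φ x)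

theorem abs_uu_le (hw : Wgt G w δ) (hc : CostOK G w c) (φ : StatProfile G) (t : ℕ) (x : X) :
    |uu G c φ t x| ≤ δ ^ t * w x := by
  have hd : 0 ≤ δ := zero_le_one.trans hw.2.1
  induction t generalizing x with
  | zero => rw [pow_zero, one_mul]; exact abs_int_c_le G hc (good_law G φ x)
  | succ t ih =>
    have := abs_int_nxt_le G hw (good_law G φ x) (pow_nonneg hd t) ih
    rw [pow_succ, mul_assoc]; exact this

/-- Value of a stationary profile from state `x`. -/
noncomputable def VV (c : X → JA A → ℝ) (φ : StatProfile G) (x : X) : ℝ :=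
  (1 - G.α) * ∑' t, G.α ^ t * uu G c φ t x

/-- The bound constant. -/
noncomputable def CV (δ : ℝ) : ℝ := ∑' t : ℕ, (δ * G.α) ^ t

theorem term_bound (hw : Wgt G w δ) (hc : CostOK G w c) (φ : StatProfile G) (t : ℕ) (x : X) :
    |G.α ^ t * uu G c φ t x| ≤ (δ * G.α) ^ t * w x := by
  have hα := G.hα0
  rw [abs_mul, abs_of_nonneg (by positivity : 0 ≤ G.α ^ t), mul_pow]
  calc G.α ^ t * |uu G c φ t x| ≤ G.α ^ t * (δ ^ t * w x) := by
        gcongr; exact abs_uu_le G hw hc φ t x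
    _ = _ := by ring

theorem summable_dα (hw : Wgt G w δ) : Summable fun t : ℕ => (δ * G.α) ^ t := by
  have hα := G.hα0
  have hd : 0 ≤ δ := zero_le_one.trans hw.2.1
  exact summable_geometric_of_lt_one (by positivity) hw.2.2.1

theorem CV_nonneg (hw : Wgt G w δ) : 0 ≤ CV G δ := by
  have hα := G.hα0
  have hd : 0 ≤ δ := zero_le_one.trans hw.2.1
  exact tsum_nonneg fun t => by positivity

theorem summable_uu (hw : Wgt G w δ) (hc : CostOK G w c) (φ : StatProfile G) (x : X) :
    Summable fun t => G.α ^ t * uu G c φ t x :=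
  Summable.of_norm_bounded ((summable_dα G hw).mul_right (w x))
    fun t => term_bound G hw hc φ t x

theorem abs_VV_le (hw : Wgt G w δ) (hc : CostOK G w c) (φ : StatProfile G) (x : X) :
    |VV G c φ x| ≤ CV G δ * w x := by
  have h1 : ‖∑' t, G.α ^ t * uu G c φ t x‖ ≤ CV G δ * w x :=
    tsum_of_norm_bounded ((summable_dα G hw).hasSum.mul_right (w x))
      fun t => term_bound G hw hc φ t x
  have hα := G.hα0
  have hα1 := G.hα1
  rw [VV, abs_mul, abs_of_nonneg (by linarith : 0 ≤ 1 - G.α)]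
  rw [Real.norm_eq_abs] at h1
  calc (1 - G.α) * |∑' t, G.α ^ t * uu G c φ t x| ≤ 1 * |∑' t, G.α ^ t * uu G c φ t x| := by
        gcongr; linarith
    _ ≤ _ := by simpa using h1

theorem bellman (hw : Wgt G w δ) (hc : CostOK G w c) (φ : StatProfile G) (x : X) :
    oneStep G c (VV G c φ) x (law G φ x) = VV G c φ x := by
  have hα := G.hα0
  have hd : 0 ≤ δ := zero_le_one.trans hw.2.1
  have hg := good_law G φ x
  have wi := intgble_nxt G hw hg (C := 1) (w_bound G hw)
  have hb : ∀ t y, |G.α ^ t * uu G c φ t y| ≤ (δ * G.α) ^ t * w y := term_bound G hw hc φ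
  have hi : ∀ t, Integrable (fun y => G.α ^ t * uu G c φ t y) (nxt G x (law G φ x)) :=
    fun t => intgble_nxt G hw hg (hb t)
  have hs := hasSum_integral_of_summable_integral_norm hi (by
    refine Summable.of_nonneg_of_le (fun t => integral_nonneg fun y => norm_nonneg _) (fun t => ?_)
      ((summable_dα G hw).mul_right (∫ y, w y ∂nxt G x (law G φ x)))
    rw [← integral_const_mul]
    exact integral_mono (hi t).norm (wi.const_mul _) (hb t))
  have e1 : ∫ y, VV G c φ y ∂nxt G x (law G φ x) =
      (1 - G.α) * ∑' t, G.α ^ t * uu G c φ (t + 1) x := by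
    simp only [VV]
    rw [integral_const_mul, ← hs.tsum_eq]
    congr 1
    refine tsum_congr fun t => ?_
    rw [integral_const_mul]; rfl
  have e2 := (summable_uu G hw hc φ x).tsum_eq_zero_add
  rw [oneStep, e1, VV, e2]
  have e3 : ∑' t, G.α ^ (t + 1) * uu G c φ (t + 1) x
      = G.α * ∑' t, G.α ^ t * uu G c φ (t + 1) x := by
    rw [← tsum_mul_left]; refine tsum_congr fun t => ?_
    rw [pow_succ]; ring
  rw [e3]
  simp only [uu]
  ring

theorem J_stat (hw : Wgt G w δ) (hc : CostOK G w c) (φ : StatProfile G) :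
    Jfun G G.η c (ofStatAll G φ) = ∫ y, VV G c φ y ∂G.η := by
  have h := verif G hw hc (CV_nonneg G hw) (abs_VV_le G hw hc φ) (ofStatAll G φ)
  have e : ∀ t h, oneStep G c (VV G c φ) (lastState X (JA A) t h)
      (jointLaw G (ofStatAll G φ) t h) - VV G c φ (lastState X (JA A) t h) = 0 := by
    intro t h
    rw [show jointLaw G (ofStatAll G φ) t h = law G φ (lastState X (JA A) t h) from rfl,
      bellman G hw hc, sub_self]
  simp only [e, integral_zero, mul_zero] at h
  have := h.unique hasSum_zero
  linarith

theorem updStat_same (φ : StatProfile G) (i : Fin n) (θ : Stat G i) : updStat G φ i θ i = θ :=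
  Function.update_self _ _ _

theorem updStat_ne (φ : StatProfile G) {i j : Fin n} (hj : j ≠ i) (θ : Stat G i) :
    updStat G φ i θ j = φ j :=
  Function.update_of_ne hj _ _

theorem jointLaw_combine (φ : StatProfile G) (i : Fin n) (σ : Strategy G i) (t : ℕ)
    (h : Hist X (JA A) t) : ∃ θ : Stat G i,
    jointLaw G (combine G (ofStatAll G φ) i σ) t h =
      law G (updStat G φ i θ) (lastState X (JA A) t h) := by
  classical
  refine ⟨mkStat G (Function.update (stAt G (φ i)) (lastState X (JA A) t h) (σ.f t h))
    fun x => ?_, ?_⟩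
  · by_cases hx : x = lastState X (JA A) t h
    · subst hx; simpa using σ.supp t h
    · rw [Function.update_of_ne hx]; exact stAt_supp G (φ i) x
  · rw [jointLaw, law]
    congr 1
    funext j
    by_cases hj : j = i
    · subst hj; rw [updStat_same, stAt_mkStat, combine, Function.update_self, Function.update_self]
    · rw [updStat_ne G φ hj, combine, Function.update_of_ne hj]; rfl

theorem deviation (hw : Wgt G w δ) {ι : Type} [Fintype ι] (cs : ι → X → JA A → ℝ)
    (hc : ∀ k, CostOK G w (cs k)) (φ : StatProfile G) (i : Fin n) (lam : ι → ℝ)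
    (hopt : ∀ x (θ : Stat G i), ∑ k, lam k * VV G (cs k) φ x ≤
      ∑ k, lam k * oneStep G (cs k) (VV G (cs k) φ) x (law G (updStat G φ i θ) x))
    (σ : Strategy G i) :
    ∑ k, lam k * Jfun G G.η (cs k) (ofStatAll G φ) ≤
      ∑ k, lam k * Jfun G G.η (cs k) (combine G (ofStatAll G φ) i σ) := by
  set π := combine G (ofStatAll G φ) i σ with hπ
  have h := hasSum_sum (s := Finset.univ) fun k _ =>
    (verif G hw (hc k) (CV_nonneg G hw) (abs_VV_le G hw (hc k) φ) π).mul_left (lam k)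
  have h0 := h.nonneg fun t => ?_
  · simp only [← J_stat G hw (hc _), mul_sub, Finset.sum_sub_distrib] at h0
    linarith
  · have e : ∑ k, lam k * (G.α ^ t * ∫ h, (oneStep G (cs k) (VV G (cs k) φ) (lastState X (JA A) t h)
        (jointLaw G π t h) - VV G (cs k) φ (lastState X (JA A) t h)) ∂(histMeas G G.η π t)) =
        G.α ^ t * ∫ h, ∑ k, lam k * (oneStep G (cs k) (VV G (cs k) φ) (lastState X (JA A) t h)
        (jointLaw G π t h) - VV G (cs k) φ (lastState X (JA A) t h)) ∂(histMeas G G.η π t) := by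
      rw [integral_finsetSum _ fun k _ => (intgble_gap G hw (hc k) (CV_nonneg G hw)
        (abs_VV_le G hw (hc k) φ) π t).const_mul (lam k), Finset.mul_sum]
      refine Finset.sum_congr rfl fun k _ => ?_
      rw [integral_const_mul]; ring
    rw [e]
    refine mul_nonneg (pow_nonneg G.hα0.le t) (integral_nonneg fun h => ?_)
    obtain ⟨θ, hθ⟩ := jointLaw_combine G φ i σ t h
    have := hopt (lastState X (JA A) t h) θ
    simp only [mul_sub, Finset.sum_sub_distrib, Pi.zero_apply]
    rw [hπ, hθ]
    linarith

end Values
end CSGame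

open MeasureTheory ProbabilityTheory Filter Topology
open scoped ENNReal NNReal
namespace CSGame
section Topo
set_option linter.unusedSectionVars false
variable {n l : ℕ}
variable {X : Type} [Countable X] [MeasurableSpace X] [DiscreteMeasurableSpace X]
  [TopologicalSpace X] [DiscreteTopology X] [BorelSpace X] [SecondCountableTopology X]
variable {A : Fin n → Type} [∀ i, MeasurableSpace (A i)] [∀ i, TopologicalSpace (A i)]
  [∀ i, PolishSpace (A i)] [∀ i, BorelSpace (A i)]
variable (G : GameData n l X A)

/-- bundle a probability measure -/
noncomputable def mkPM {Ω : Type*} [MeasurableSpace Ω] (m : Measure Ω)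
    (h : IsProbabilityMeasure m) : ProbabilityMeasure Ω := ⟨m, h⟩

theorem mkPM_coe {Ω : Type*} [MeasurableSpace Ω] (m : Measure Ω)
    (h : IsProbabilityMeasure m) : (mkPM m h : Measure Ω) = m := rfl

theorem pm_eq_one {Ω : Type*} [MeasurableSpace Ω] (m : ProbabilityMeasure Ω) (s : Set Ω) :
    m s = 1 ↔ (m : Measure Ω) s = 1 := by
  rw [← ENNReal.coe_inj, ProbabilityMeasure.ennreal_coeFn_eq_coeFn_toMeasure]; simp

theorem continuous_stAt (i : Fin n) (x : X) : Continuous fun θ : Stat G i => stAt G θ x :=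
  (continuous_apply x).comp continuous_subtype_val

theorem isCompact_carried (i : Fin n) (x : X) :
    IsCompact {μ : ProbabilityMeasure (A i) | μ (G.As i x) = 1} := by
  have h := isCompact_setOfPred_probabilityMeasure_mass_eq_compl_isCompact_le (E := A i)
    (u := fun _ => 0) (K := fun _ => G.As i x) tendsto_const_nhds (fun _ => G.hAs_cpt i x)
    (Or.inr monotone_const)
  convert h using 1
  ext μ
  have hm : MeasurableSet (G.As i x) := (G.hAs_cpt i x).isClosed.measurableSet
  have := prob_compl_eq_zero_iff (μ := (μ : Measure (A i))) hm
  simp only [Set.mem_ofPred_eq, nonpos_iff_eq_zero, forall_const]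
  rw [← ENNReal.coe_inj, ← ENNReal.coe_inj, ProbabilityMeasure.ennreal_coeFn_eq_coeFn_toMeasure,
    ProbabilityMeasure.ennreal_coeFn_eq_coeFn_toMeasure]
  simpa using this.symm

instance compactSpace_Stat (i : Fin n) : CompactSpace (Stat G i) := by
  have h : IsCompact (Set.univ.pi fun x => {μ : ProbabilityMeasure (A i) | μ (G.As i x) = 1}) :=
    isCompact_univ_pi fun x => isCompact_carried G i x
  have e : (Set.univ.pi fun x => {μ : ProbabilityMeasure (A i) | μ (G.As i x) = 1}) =
      {φ : X → ProbabilityMeasure (A i) | ∀ x, φ x (G.As i x) = 1} := by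
    ext φ; simp [Set.mem_pi]
  rw [e] at h
  exact isCompact_iff_compactSpace.1 h

instance nonempty_Stat (i : Fin n) : Nonempty (Stat G i) := by
  choose a ha using G.hAs_ne i
  refine ⟨mkStat G (fun x => mkPM (Measure.dirac (a x)) inferInstance) fun x => ?_⟩
  rw [pm_eq_one, mkPM_coe]
  simp [Measure.dirac_apply' _ (G.hAs_cpt i x).isClosed.measurableSet, ha x]

/-- the joint law as a probability measure -/
noncomputable def lawP (φ : StatProfile G) (x : X) : ProbabilityMeasure (JA A) :=
  ProbabilityMeasure.pi fun j => stAt G (φ j) x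

theorem continuous_lawP (x : X) : Continuous fun φ : StatProfile G => lawP G φ x :=
  ProbabilityMeasure.continuous_pi.comp
    (continuous_pi fun j => (continuous_stAt G j x).comp (continuous_apply j))

theorem isCompact_jointSet (x : X) : IsCompact (jointSet G x) :=
  isCompact_univ_pi fun i => G.hAs_cpt i x

theorem continuous_int_law (x : X) {u : JA A → ℝ} (hu : ContinuousOn u (jointSet G x)) :
    Continuous fun φ : StatProfile G => ∫ a, u a ∂law G φ x := by
  have hK := isCompact_jointSet G x
  have : CompactSpace (jointSet G x) := isCompact_iff_compactSpace.1 hK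
  let f : BoundedContinuousFunction (jointSet G x) ℝ :=
    BoundedContinuousFunction.mkOfCompact ⟨_, continuousOn_iff_continuous_domRestrict.1 hu⟩
  obtain ⟨g, -, hg⟩ := f.exists_norm_eq_domRestrict_eq_of_closed hK.isClosed
  have e : (fun φ : StatProfile G => ∫ a, u a ∂law G φ x) =
      fun φ => ∫ a, g a ∂(lawP G φ x : Measure (JA A)) := by
    funext φ
    refine integral_congr_ae ((good_law G φ x).supp.mono fun a ha => ?_)
    have := DFunLike.congr_fun hg ⟨a, ha⟩
    exact this.symm
  rw [e]
  exact (ProbabilityMeasure.continuous_integral_boundedContinuousFunction g).comp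
    (continuous_lawP G x)

theorem continuous_tsum_weighted {Z Y : Type*} [TopologicalSpace Z] (q : Z → Y → ℝ) (w : Y → ℝ)
    (W : Z → ℝ) (v : Z → Y → ℝ) (C : ℝ) (hq0 : ∀ z y, 0 ≤ q z y) (hqc : ∀ y, Continuous fun z => q z y)
    (hw0 : ∀ y, 0 ≤ w y) (hC : 0 ≤ C)
    (hW : ∀ z, HasSum (fun y => q z y * w y) (W z)) (hWc : Continuous W)
    (hvc : ∀ y, Continuous fun z => v z y) (hv : ∀ z y, |v z y| ≤ C * w y) :
    Continuous fun z => ∑' y, q z y * v z y := by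
  have hlu : TendstoLocallyUniformly (fun (F : Finset Y) z => ∑ y ∈ F, q z y * v z y)
      (fun z => ∑' y, q z y * v z y) atTop := by
    rw [Metric.tendstoLocallyUniformly_iff]
    intro ε hε z0
    obtain ⟨F0, hF0⟩ : ∃ F0 : Finset Y, C * (W z0 - ∑ y ∈ F0, q z0 y * w y) < ε := by
      have h1 : Tendsto (fun F : Finset Y => C * (W z0 - ∑ y ∈ F, q z0 y * w y)) atTop
          (𝓝 (C * (W z0 - W z0))) := (tendsto_const_nhds.sub (hW z0)).const_mul C
      rw [sub_self, mul_zero] at h1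
      exact (h1.eventually_lt_const hε).exists
    have hcont : Continuous fun z => C * (W z - ∑ y ∈ F0, q z y * w y) := by
      refine continuous_const.mul (hWc.sub (continuous_finsetSum _ fun y _ => ?_))
      exact (hqc y).mul continuous_const
    refine ⟨{z | C * (W z - ∑ y ∈ F0, q z y * w y) < ε},
      hcont.continuousAt.eventually_lt_const hF0, ?_⟩
    filter_upwards [eventually_ge_atTop F0] with F hF z hz
    have hle : ∀ y, ‖q z y * v z y‖ ≤ C * (q z y * w y) := fun y => by
      rw [Real.norm_eq_abs, abs_mul, abs_of_nonneg (hq0 z y)]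
      have := mul_le_mul_of_nonneg_left (hv z y) (hq0 z y)
      linarith
    have hs : Summable fun y => q z y * v z y :=
      Summable.of_norm_bounded ((hW z).summable.mul_left C) hle
    have h1 := hs.sum_add_tsum_subtype_compl F
    have h2 := (hW z).summable.sum_add_tsum_subtype_compl F
    rw [(hW z).tsum_eq] at h2
    have h3 : ‖∑' y : {y // y ∉ F}, q z y * v z y‖ ≤ C * ∑' y : {y // y ∉ F}, q z y * w y := by
      refine tsum_of_norm_bounded (g := fun y : {y // y ∉ F} => C * (q z y * w y))
        (((hW z).summable.subtype _).hasSum.mul_left C) fun y => hle y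
    have h4 : ∑ y ∈ F0, q z y * w y ≤ ∑ y ∈ F, q z y * w y :=
      Finset.sum_le_sum_of_subset_of_nonneg hF fun y _ _ => mul_nonneg (hq0 z y) (hw0 y)
    rw [Real.dist_eq, ← h1, add_sub_cancel_left]
    rw [Real.norm_eq_abs] at h3
    have h5 : C * ∑' y : {y // y ∉ F}, q z y * w y ≤ C * (W z - ∑ y ∈ F0, q z y * w y) := by
      refine mul_le_mul_of_nonneg_left ?_ hC
      linarith
    have hz' : C * (W z - ∑ y ∈ F0, q z y * w y) < ε := hz
    linarith
  refine hlu.continuous (Eventually.of_forall fun F => ?_).frequently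
  exact continuous_finsetSum _ fun y _ => (hqc y).mul (hvc y)

theorem hasSum_integral_pt (m : Measure X) {v : X → ℝ} (hv : Integrable v m) :
    HasSum (fun y => m.real {y} * v y) (∫ y, v y ∂m) := by
  have h := hasSum_integral_iUnion (μ := m) (f := v) (s := fun y : X => {y})
    (fun y => measurableSet_singleton y) (fun y z hyz => by simpa using hyz) hv.integrableOn
  rw [Set.iUnion_of_singleton] at h
  simpa [measureReal_def] using h

variable {w : X → ℝ} {δ : ℝ} {c : X → JA A → ℝ}

theorem continuous_int_weighted {Z : Type*} [TopologicalSpace Z] (m : Z → Measure X)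
    (hwp : ∀ x, 1 ≤ w x)
    (hm : ∀ z, ∫⁻ y, ENNReal.ofReal (w y) ∂m z < ⊤)
    (hmc : ∀ y, Continuous fun z => (m z).real {y})
    (hWc : Continuous fun z => ∫ y, w y ∂m z)
    (v : Z → X → ℝ) {C : ℝ} (hC : 0 ≤ C) (hvc : ∀ y, Continuous fun z => v z y)
    (hv : ∀ z y, |v z y| ≤ C * w y) : Continuous fun z => ∫ y, v z y ∂m z := by
  have h0 : ∀ x, 0 ≤ w x := fun x => zero_le_one.trans (hwp x)
  have e : (fun z => ∫ y, v z y ∂m z) = fun z => ∑' y, (m z).real {y} * v z y := by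
    funext z
    exact (hasSum_integral_pt (m z) (intgble (hm z) hwp (hv z))).tsum_eq.symm
  rw [e]
  refine continuous_tsum_weighted (fun z y => (m z).real {y}) w (fun z => ∫ y, w y ∂m z) v C
    (fun _ y => measureReal_nonneg) hmc h0 hC (fun z => ?_) hWc hvc hv
  exact hasSum_integral_pt (m z) (intgble (hm z) hwp (C := 1) fun y => by
    rw [abs_of_nonneg (h0 y), one_mul])

theorem continuous_nxt_pt (hA : AssumptionA1 G) (x y : X) :
    Continuous fun φ : StatProfile G => (nxt G x (law G φ x)).real {y} := by
  have hp := G.hp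
  have e : (fun φ : StatProfile G => (nxt G x (law G φ x)).real {y}) =
      fun φ => ∫ a, (G.p x a {y}).toReal ∂law G φ x := by
    funext φ
    rw [measureReal_def, nxt, Measure.bind_apply (measurableSet_singleton y)
      (measurable_p G x).aemeasurable, integral_toReal (G.hpm x y).aemeasurable]
    exact ae_of_all _ fun a => measure_lt_top _ _
  rw [e]
  refine continuous_int_law G x fun a ha => ?_
  exact (ENNReal.tendsto_toReal (measure_ne_top _ _)).comp (hA x y a ha)

theorem continuous_nxt_w (hw : Wgt G w δ)
    (hWc : ∀ x, ContinuousOn (fun a => ∫⁻ y, ENNReal.ofReal (w y) ∂(G.p x a)) (jointSet G x))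
    (x : X) : Continuous fun φ : StatProfile G => ∫ y, w y ∂(nxt G x (law G φ x)) := by
  have h0 : ∀ x, 0 ≤ w x := fun x => zero_le_one.trans (hw.1 x)
  have e : (fun φ : StatProfile G => ∫ y, w y ∂(nxt G x (law G φ x))) =
      fun φ => ∫ a, (∫⁻ y, ENNReal.ofReal (w y) ∂(G.p x a)).toReal ∂law G φ x := by
    funext φ
    rw [integral_eq_lintegral_of_nonneg_ae (ae_of_all _ h0)
      Measurable.of_discrete.aestronglyMeasurable, lintegral_nxt, integral_toReal]
    · exact ((Measure.measurable_lintegral Measurable.of_discrete).comp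
        (measurable_p G x)).aemeasurable
    · exact (good_law G φ x).supp.mono fun a ha =>
        (hw.2.2.2.1 x a ha).trans_lt ENNReal.ofReal_lt_top
  rw [e]
  refine continuous_int_law G x fun a ha => ?_
  exact (ENNReal.tendsto_toReal ((hw.2.2.2.1 x a ha).trans_lt ENNReal.ofReal_lt_top).ne).comp
    (hWc x a ha)

/-- The continuity hypotheses. -/
def Cnt (w : X → ℝ) : Prop := AssumptionA1 G ∧
  ∀ x, ContinuousOn (fun a => ∫⁻ y, ENNReal.ofReal (w y) ∂(G.p x a)) (jointSet G x)

theorem continuous_int_nxt (hw : Wgt G w δ) (hA : Cnt G w) {Z : Type*} [TopologicalSpace Z]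
    (θ : Z → StatProfile G) (hθ : Continuous θ) (x : X)
    (v : Z → X → ℝ) {C : ℝ} (hC : 0 ≤ C) (hvc : ∀ y, Continuous fun z => v z y)
    (hv : ∀ z y, |v z y| ≤ C * w y) :
    Continuous fun z => ∫ y, v z y ∂nxt G x (law G (θ z) x) :=
  continuous_int_weighted (fun z => nxt G x (law G (θ z) x)) hw.1
    (fun _ => (lint_nxt_le G hw (good_law G _ x)).trans_lt ENNReal.ofReal_lt_top)
    (fun y => (continuous_nxt_pt G hA.1 x y).comp hθ)
    ((continuous_nxt_w G hw hA.2 x).comp hθ) v hC hvc hv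

theorem continuous_uu (hw : Wgt G w δ) (hA : Cnt G w) (hc : CostOK G w c)
    (hcc : ∀ x, ContinuousOn (c x) (jointSet G x)) (t : ℕ) (x : X) :
    Continuous fun φ : StatProfile G => uu G c φ t x := by
  have hd : 0 ≤ δ := zero_le_one.trans hw.2.1
  induction t generalizing x with
  | zero => exact continuous_int_law G x (hcc x)
  | succ t ih =>
    exact continuous_int_nxt G hw hA (fun φ => φ) continuous_id x (fun φ y => uu G c φ t y)
      (pow_nonneg hd t) ih (fun φ y => abs_uu_le G hw hc φ t y)

theorem continuous_VV (hw : Wgt G w δ) (hA : Cnt G w) (hc : CostOK G w c)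
    (hcc : ∀ x, ContinuousOn (c x) (jointSet G x)) (x : X) :
    Continuous fun φ : StatProfile G => VV G c φ x :=
  continuous_const.mul (continuous_tsum
    (fun t => continuous_const.mul (continuous_uu G hw hA hc hcc t x))
    ((summable_dα G hw).mul_right (w x)) fun t φ => term_bound G hw hc φ t x)

theorem continuous_oneStep (hw : Wgt G w δ) (hA : Cnt G w) (hc : CostOK G w c)
    (hcc : ∀ x, ContinuousOn (c x) (jointSet G x)) (x : X) {Z : Type*} [TopologicalSpace Z]
    (φ θ : Z → StatProfile G) (hφ : Continuous φ) (hθ : Continuous θ) :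
    Continuous fun z => oneStep G c (VV G c (φ z)) x (law G (θ z) x) :=
  (continuous_const.mul ((continuous_int_law G x (hcc x)).comp hθ)).add
    (continuous_const.mul (continuous_int_nxt G hw hA θ hθ x (fun z y => VV G c (φ z) y)
      (CV_nonneg G hw) (fun y => (continuous_VV G hw hA hc hcc y).comp hφ)
      fun z y => abs_VV_le G hw hc (φ z) y))

theorem continuous_J (hw : Wgt G w δ) (hA : Cnt G w) (hc : CostOK G w c)
    (hcc : ∀ x, ContinuousOn (c x) (jointSet G x)) :
    Continuous fun φ : StatProfile G => Jfun G G.η c (ofStatAll G φ) := by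
  simp only [J_stat G hw hc]
  exact continuous_int_weighted (fun _ => G.η) hw.1 (fun _ => hw.2.2.2.2)
    (fun _ => continuous_const) continuous_const _ (CV_nonneg G hw)
    (continuous_VV G hw hA hc hcc) fun φ y => abs_VV_le G hw hc φ y

end Topo
end CSGame

open MeasureTheory ProbabilityTheory Filter Topology
open scoped ENNReal NNReal
namespace CSGame
section Mix
set_option linter.unusedSectionVars false
variable {n l : ℕ}
variable {X : Type} [Countable X] [MeasurableSpace X] [DiscreteMeasurableSpace X]
  [TopologicalSpace X] [DiscreteTopology X] [BorelSpace X] [SecondCountableTopology X]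
variable {A : Fin n → Type} [∀ i, MeasurableSpace (A i)] [∀ i, TopologicalSpace (A i)]
  [∀ i, PolishSpace (A i)] [∀ i, BorelSpace (A i)]
variable (G : GameData n l X A)
variable {w : X → ℝ} {δ : ℝ} {c : X → JA A → ℝ}

/-- The underlying measure of a mixture. -/
noncomputable def mixM {Ω : Type*} [MeasurableSpace Ω] {m : ℕ} (t : Fin (m + 1) → ℝ)
    (q : Fin (m + 1) → Measure Ω) : Measure Ω := ∑ j, ENNReal.ofReal (t j) • q j

theorem mixM_apply {Ω : Type*} [MeasurableSpace Ω] {m : ℕ} (t : Fin (m + 1) → ℝ)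
    (q : Fin (m + 1) → Measure Ω) (s : Set Ω) :
    mixM t q s = ∑ j, ENNReal.ofReal (t j) * q j s := by
  simp [mixM]

theorem sum_ofReal {m : ℕ} {t : Fin (m + 1) → ℝ} (ht : t ∈ stdSimplex ℝ (Fin (m + 1))) :
    ∑ j, ENNReal.ofReal (t j) = 1 := by
  rw [← ENNReal.ofReal_sum_of_nonneg fun j _ => ht.1 j, ht.2, ENNReal.ofReal_one]

theorem mixM_const {Ω : Type*} [MeasurableSpace Ω] {m : ℕ} {t : Fin (m + 1) → ℝ}
    (ht : t ∈ stdSimplex ℝ (Fin (m + 1)))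
    (q : Fin (m + 1) → Measure Ω) (s : Set Ω) (hq : ∀ j, q j s = 1) : mixM t q s = 1 := by
  simp only [mixM_apply, hq, mul_one, sum_ofReal ht]

theorem integral_mixM {Ω : Type*} [MeasurableSpace Ω] {m : ℕ} {t : Fin (m + 1) → ℝ}
    (ht : t ∈ stdSimplex ℝ (Fin (m + 1))) (q : Fin (m + 1) → Measure Ω) {f : Ω → ℝ}
    (hf : ∀ j, Integrable f (q j)) : ∫ a, f a ∂mixM t q = ∑ j, t j * ∫ a, f a ∂q j := by
  rw [mixM, integral_finsetSum_measure fun j _ => (hf j).smul_measure ENNReal.ofReal_ne_top]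
  refine Finset.sum_congr rfl fun j _ => ?_
  rw [integral_smul_measure, ENNReal.toReal_ofReal (ht.1 j), smul_eq_mul]

open Classical in
/-- Mixtures of probability measures. -/
noncomputable def mixPM {Ω : Type*} [MeasurableSpace Ω] {m : ℕ} (q : Fin (m + 1) → ProbabilityMeasure Ω)
    (t : Fin (m + 1) → ℝ) : ProbabilityMeasure Ω :=
  if ht : t ∈ stdSimplex ℝ (Fin (m + 1)) then
    mkPM (mixM t fun j => (q j : Measure Ω))
      ⟨mixM_const ht _ _ fun _ => measure_univ⟩
  else q 0

theorem mixPM_coe {Ω : Type*} [MeasurableSpace Ω] {m : ℕ} (q : Fin (m + 1) → ProbabilityMeasure Ω)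
    {t : Fin (m + 1) → ℝ} (ht : t ∈ stdSimplex ℝ (Fin (m + 1))) :
    (mixPM q t : Measure Ω) = mixM t fun j => (q j : Measure Ω) := by
  rw [mixPM, dif_pos ht, mkPM_coe]

theorem mixPM_supp {Ω : Type*} [MeasurableSpace Ω] {m : ℕ} (q : Fin (m + 1) → ProbabilityMeasure Ω)
    (t : Fin (m + 1) → ℝ) (s : Set Ω) (hq : ∀ j, q j s = 1) : mixPM q t s = 1 := by
  by_cases ht : t ∈ stdSimplex ℝ (Fin (m + 1))
  · rw [pm_eq_one, mixPM_coe q ht]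
    exact mixM_const ht _ _ fun j => (pm_eq_one _ _).1 (hq j)
  · rw [mixPM, dif_neg ht]; exact hq 0

theorem continuousOn_mixPM {Ω : Type*} [MeasurableSpace Ω] [TopologicalSpace Ω]
    [OpensMeasurableSpace Ω] {m : ℕ} (q : Fin (m + 1) → ProbabilityMeasure Ω) :
    ContinuousOn (mixPM q) (stdSimplex ℝ (Fin (m + 1))) := by
  rw [continuousOn_iff_continuous_domRestrict,
    ProbabilityMeasure.continuous_iff_forall_continuous_integral]
  intro f
  have e : (fun t : stdSimplex ℝ (Fin (m + 1)) =>
      ∫ a, f a ∂((stdSimplex ℝ (Fin (m + 1))).domRestrict (mixPM q) t : Measure Ω)) =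
      fun t => ∑ j, t.1 j * ∫ a, f a ∂(q j : Measure Ω) := by
    funext t
    rw [Set.domRestrict_apply, mixPM_coe q t.2, integral_mixM t.2 _ fun j => f.integrable _]
  rw [e]
  refine continuous_finsetSum _ fun j _ => ?_
  exact ((continuous_apply j).comp continuous_subtype_val).mul continuous_const

/-- Mixtures of stationary strategies. -/
noncomputable def mixStat {i : Fin n} {m : ℕ} (q : Fin (m + 1) → Stat G i)
    (t : Fin (m + 1) → ℝ) : Stat G i :=
  mkStat G (fun x => mixPM (fun j => stAt G (q j) x) t)
    fun x => mixPM_supp _ _ _ fun j => stAt_supp G (q j) x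

theorem continuousOn_mixStat {i : Fin n} {m : ℕ} (q : Fin (m + 1) → Stat G i) :
    ContinuousOn (mixStat G q) (stdSimplex ℝ (Fin (m + 1))) := by
  rw [continuousOn_iff_continuous_domRestrict]
  refine Continuous.subtype_mk (continuous_pi fun x => ?_) _
  exact continuousOn_iff_continuous_domRestrict.1 (continuousOn_mixPM fun j => stAt G (q j) x)

theorem law_upd_pi (φ : StatProfile G) (i : Fin n) (θ : Stat G i) (x : X) (s : ∀ j, Set (A j)) :
    ∏ j, (stAt G (updStat G φ i θ j) x : Measure (A j)) (s j) =
      (stAt G θ x : Measure (A i)) (s i) *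
        ∏ j ∈ Finset.univ.erase i, (stAt G (φ j) x : Measure (A j)) (s j) := by
  rw [← Finset.mul_prod_erase _ _ (Finset.mem_univ i), updStat_same]
  congr 1
  refine Finset.prod_congr rfl fun j hj => ?_
  rw [updStat_ne G φ (Finset.ne_of_mem_erase hj)]

theorem law_mix (φ : StatProfile G) (i : Fin n) {m : ℕ} (q : Fin (m + 1) → Stat G i)
    {t : Fin (m + 1) → ℝ} (ht : t ∈ stdSimplex ℝ (Fin (m + 1))) (x : X) :
    law G (updStat G φ i (mixStat G q t)) x =
      mixM t fun j => law G (updStat G φ i (q j)) x := by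
  refine Measure.pi_eq (μ := fun j => (stAt G (updStat G φ i (mixStat G q t) j) x : Measure (A j)))
    (fun s _ => ?_)
  rw [law_upd_pi, mixM_apply, mixStat, stAt_mkStat, mixPM_coe _ ht, mixM_apply, Finset.sum_mul]
  refine Finset.sum_congr rfl fun j _ => ?_
  rw [law, Measure.pi_pi, law_upd_pi, mul_assoc]

theorem nxt_mix (x : X) {m : ℕ} (q : Fin (m + 1) → Measure (JA A)) (t : Fin (m + 1) → ℝ) :
    nxt G x (mixM t q) = mixM t fun j => nxt G x (q j) := by
  ext s hs
  rw [mixM_apply, nxt, Measure.bind_apply hs (measurable_p G x).aemeasurable, mixM,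
    lintegral_finsetSum_measure]
  refine Finset.sum_congr rfl fun j _ => ?_
  rw [lintegral_smul_measure, nxt, Measure.bind_apply hs (measurable_p G x).aemeasurable,
    smul_eq_mul]

theorem intgble_c (hc : CostOK G w c) {x : X} {m : Measure (JA A)} (hm : Good G x m) :
    Integrable (c x) m := by
  have := hm.prob
  exact Integrable.of_bound (hc.1 x).aestronglyMeasurable (w x)
    (hm.supp.mono fun a ha => hc.2 x a ha)

theorem oneStep_mix (hw : Wgt G w δ) (hc : CostOK G w c) {v : X → ℝ} {C : ℝ}
    (hv : ∀ x, |v x| ≤ C * w x) (x : X) {m : ℕ} (q : Fin (m + 1) → Measure (JA A))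
    (hq : ∀ j, Good G x (q j)) {t : Fin (m + 1) → ℝ} (ht : t ∈ stdSimplex ℝ (Fin (m + 1))) :
    oneStep G c v x (mixM t q) = ∑ j, t j * oneStep G c v x (q j) := by
  simp only [oneStep]
  rw [integral_mixM ht _ fun j => intgble_c G hc (hq j), nxt_mix,
    integral_mixM ht _ fun j => intgble_nxt G hw (hq j) hv, Finset.mul_sum, Finset.mul_sum,
    ← Finset.sum_add_distrib]
  refine Finset.sum_congr rfl fun j _ => ?_
  ring

open Classical in
/-- Mixtures of multipliers. -/
noncomputable def mixS {l m : ℕ} (q : Fin (m + 1) → stdSimplex ℝ (Fin (l + 1)))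
    (t : Fin (m + 1) → ℝ) : stdSimplex ℝ (Fin (l + 1)) :=
  if ht : t ∈ stdSimplex ℝ (Fin (m + 1)) then
    ⟨∑ j, t j • (q j).1, (convex_stdSimplex ℝ _).sum_mem (fun j _ => ht.1 j) ht.2
      fun j _ => (q j).2⟩
  else q 0

theorem mixS_apply {l m : ℕ} (q : Fin (m + 1) → stdSimplex ℝ (Fin (l + 1)))
    {t : Fin (m + 1) → ℝ} (ht : t ∈ stdSimplex ℝ (Fin (m + 1))) (k : Fin (l + 1)) :
    (mixS q t).1 k = ∑ j, t j * (q j).1 k := by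
  rw [mixS, dif_pos ht]; simp

theorem continuousOn_mixS {l m : ℕ} (q : Fin (m + 1) → stdSimplex ℝ (Fin (l + 1))) :
    ContinuousOn (mixS q) (stdSimplex ℝ (Fin (m + 1))) := by
  rw [continuousOn_iff_continuous_domRestrict]
  refine continuous_induced_rng.2 (continuous_pi fun k => ?_)
  have e : (fun t : stdSimplex ℝ (Fin (m + 1)) =>
      (((stdSimplex ℝ (Fin (m + 1))).domRestrict (mixS q)) t).1 k) =
      fun t => ∑ j, t.1 j * (q j).1 k := by
    funext t; rw [Set.domRestrict_apply, mixS_apply q t.2]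
  exact e ▸ (continuous_finsetSum _ fun j _ =>
    ((continuous_apply j).comp continuous_subtype_val).mul continuous_const)

end Mix
end CSGame

open MeasureTheory ProbabilityTheory Filter Topology
open scoped ENNReal NNReal
namespace CSGame
section Final
set_option linter.unusedSectionVars false
variable {n l : ℕ}
variable {X : Type} [Countable X] [MeasurableSpace X] [DiscreteMeasurableSpace X]
  [TopologicalSpace X] [DiscreteTopology X] [BorelSpace X] [SecondCountableTopology X]
variable {A : Fin n → Type} [∀ i, MeasurableSpace (A i)] [∀ i, TopologicalSpace (A i)]
  [∀ i, PolishSpace (A i)] [∀ i, BorelSpace (A i)]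
variable (G : GameData n l X A)
variable {w : X → ℝ} {δ : ℝ}

/-- The advantage of staying with `φ` over the one-shot deviation `θ`. -/
noncomputable def RR (i : Fin n) (x : X) (φ : StatProfile G) (lam : Fin (l + 1) → ℝ)
    (θ : Stat G i) : ℝ :=
  ∑ k, lam k * (VV G (G.c i k) φ x -
    oneStep G (G.c i k) (VV G (G.c i k) φ) x (law G (updStat G φ i θ) x))

/-- The constraint slack. -/
noncomputable def gg (i : Fin n) (k : Fin (l + 1)) (φ : StatProfile G) : ℝ :=
  if k = 0 then 0 else J G i k (ofStatAll G φ) - G.κ i k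

theorem continuous_RR (hw : Wgt G w δ) (hA : Cnt G w) (hc : ∀ i k, CostOK G w (G.c i k))
    (hcc : ∀ i k x, ContinuousOn (G.c i k x) (jointSet G x)) (i : Fin n) (x : X) (θ : Stat G i)
    {Z : Type*} [TopologicalSpace Z] (φ : Z → StatProfile G) (hφ : Continuous φ)
    (lam : Z → Fin (l + 1) → ℝ) (hlam : ∀ k, Continuous fun z => lam z k) :
    Continuous fun z => RR G i x (φ z) (lam z) θ := by
  refine continuous_finsetSum _ fun k _ => (hlam k).mul (Continuous.sub ?_ ?_)
  · exact (continuous_VV G hw hA (hc i k) (hcc i k) x).comp hφ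
  · exact continuous_oneStep G hw hA (hc i k) (hcc i k) x φ (fun z => updStat G (φ z) i θ) hφ
      (Continuous.update hφ i continuous_const)

theorem continuous_gg (hw : Wgt G w δ) (hA : Cnt G w) (hc : ∀ i k, CostOK G w (G.c i k))
    (hcc : ∀ i k x, ContinuousOn (G.c i k x) (jointSet G x)) (i : Fin n) (k : Fin (l + 1)) :
    Continuous fun φ => gg G i k φ := by
  by_cases hk : k = 0
  · simp only [gg, hk, if_true]; exact continuous_const
  · simp only [gg, hk, if_false]
    exact (continuous_J G hw hA (hc i k) (hcc i k)).sub continuous_const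

theorem RR_self (hw : Wgt G w δ) (hc : ∀ i k, CostOK G w (G.c i k)) (i : Fin n) (x : X)
    (φ : StatProfile G) (lam : Fin (l + 1) → ℝ) : RR G i x φ lam (φ i) = 0 := by
  have e : updStat G φ i (φ i) = φ := Function.update_eq_self i φ
  rw [RR, e]
  exact Finset.sum_eq_zero fun k _ => by rw [bellman G hw (hc i k), sub_self, mul_zero]

theorem law_congr (φ : StatProfile G) (i : Fin n) (x : X) (θ θ' : Stat G i)
    (h : stAt G θ x = stAt G θ' x) :
    law G (updStat G φ i θ) x = law G (updStat G φ i θ') x := by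
  have e : (fun j => stAt G (updStat G φ i θ j) x) = fun j => stAt G (updStat G φ i θ' j) x := by
    funext j
    by_cases hj : j = i
    · subst hj; rw [updStat_same, updStat_same, h]
    · rw [updStat_ne G φ hj, updStat_ne G φ hj]
  exact congrArg (fun q : ∀ j, ProbabilityMeasure (A j) =>
    Measure.pi fun j => (q j : Measure (A j))) e

theorem RR_congr (φ : StatProfile G) (lam : Fin (l + 1) → ℝ) (i : Fin n) (x : X) (θ θ' : Stat G i)
    (h : stAt G θ x = stAt G θ' x) : RR G i x φ lam θ = RR G i x φ lam θ' := by
  rw [RR, RR, law_congr G φ i x θ θ' h]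

theorem RR_mix (hw : Wgt G w δ) (hc : ∀ i k, CostOK G w (G.c i k)) (i : Fin n) (x : X)
    (φ : StatProfile G) (lam : Fin (l + 1) → ℝ) {m : ℕ} (q : Fin (m + 1) → Stat G i)
    {t : Fin (m + 1) → ℝ} (ht : t ∈ stdSimplex ℝ (Fin (m + 1))) :
    RR G i x φ lam (mixStat G q t) = ∑ j, t j * RR G i x φ lam (q j) := by
  simp only [RR, Finset.mul_sum]
  rw [Finset.sum_comm]
  refine Finset.sum_congr rfl fun k _ => ?_
  rw [law_mix G φ i q ht x, oneStep_mix G hw (hc i k) (abs_VV_le G hw (hc i k) φ) x _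
    (fun j => good_law G _ x) ht]
  have h1 : VV G (G.c i k) φ x = ∑ j, t j * VV G (G.c i k) φ x := by
    rw [← Finset.sum_mul, ht.2, one_mul]
  rw [h1, ← Finset.sum_sub_distrib, Finset.mul_sum, ← h1]
  exact Finset.sum_congr rfl fun j _ => by ring

/-- The product of stationary profiles and multipliers. -/
abbrev KK : Type _ := StatProfile G × (Fin n → stdSimplex ℝ (Fin (l + 1)))

instance compactSpace_SP : CompactSpace (StatProfile G) :=
  inferInstanceAs (CompactSpace (∀ i, Stat G i))

instance nonempty_SP : Nonempty (StatProfile G) :=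
  inferInstanceAs (Nonempty (∀ i, Stat G i))

/-- The Nikaido-Isoda type function. -/
noncomputable def ff (S : Finset X) (z y : KK G) : ℝ :=
  ∑ i, (∑ x ∈ S, RR G i x z.1 (z.2 i).1 (y.1 i) +
    ∑ k, ((y.2 i).1 k - (z.2 i).1 k) * gg G i k z.1)

theorem continuous_mult (i : Fin n) (k : Fin (l + 1)) :
    Continuous fun z : KK G => (z.2 i).1 k :=
  (continuous_apply k).comp (continuous_subtype_val.comp ((continuous_apply i).comp continuous_snd))

theorem continuous_ff (hw : Wgt G w δ) (hA : Cnt G w) (hc : ∀ i k, CostOK G w (G.c i k))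
    (hcc : ∀ i k x, ContinuousOn (G.c i k x) (jointSet G x)) (S : Finset X) (y : KK G) :
    Continuous fun z => ff G S z y := by
  refine continuous_finsetSum _ fun i _ => Continuous.add ?_ ?_
  · exact continuous_finsetSum _ fun x _ => continuous_RR G hw hA hc hcc i x _ _ continuous_fst _
      fun k => continuous_mult G i k
  · exact continuous_finsetSum _ fun k _ => (continuous_const.sub (continuous_mult G i k)).mul
      ((continuous_gg G hw hA hc hcc i k).comp continuous_fst)

theorem ff_self (hw : Wgt G w δ) (hc : ∀ i k, CostOK G w (G.c i k)) (S : Finset X) (z : KK G) :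
    ff G S z z = 0 := by
  refine Finset.sum_eq_zero fun i _ => ?_
  simp only [RR_self G hw hc, Finset.sum_const_zero, sub_self, zero_mul, add_zero]

theorem ff_mix (hw : Wgt G w δ) (hc : ∀ i k, CostOK G w (G.c i k)) (S : Finset X)
    {m : ℕ} (y : Fin (m + 1) → KK G) {t : Fin (m + 1) → ℝ} (ht : t ∈ stdSimplex ℝ (Fin (m + 1)))
    (z : KK G) :
    ff G S z (fun i => mixStat G (fun j => (y j).1 i) t, fun i => mixS (fun j => (y j).2 i) t) =
      ∑ j, t j * ff G S z (y j) := by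
  simp only [ff, Finset.mul_sum]
  rw [Finset.sum_comm]
  refine Finset.sum_congr rfl fun i _ => ?_
  simp only [mul_add, Finset.sum_add_distrib, Finset.mul_sum]
  congr 1
  · rw [Finset.sum_comm]
    exact Finset.sum_congr rfl fun x _ => RR_mix G hw hc i x _ _ _ ht
  · rw [Finset.sum_comm]
    refine Finset.sum_congr rfl fun k _ => ?_
    rw [mixS_apply _ ht]
    have h1 : (z.2 i).1 k = ∑ j, t j * (z.2 i).1 k := by
      rw [← Finset.sum_mul, ht.2, one_mul]
    rw [h1, ← Finset.sum_sub_distrib, Finset.sum_mul, ← h1]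
    exact Finset.sum_congr rfl fun j _ => by ring

theorem exists_ff (hw : Wgt G w δ) (hA : Cnt G w) (hc : ∀ i k, CostOK G w (G.c i k))
    (hcc : ∀ i k x, ContinuousOn (G.c i k x) (jointSet G x)) (S : Finset X) :
    ∃ z, ∀ y, ff G S z y ≤ 0 := by
  refine kyFan (ff G S) (continuous_ff G hw hA hc hcc S) (fun z => (ff_self G hw hc S z).le)
    fun m y => ⟨fun t => (fun i => mixStat G (fun j => (y j).1 i) t,
      fun i => mixS (fun j => (y j).2 i) t), ?_, fun t ht z => ff_mix G hw hc S y ht z⟩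
  refine ContinuousOn.prodMk ?_ ?_
  · exact continuousOn_pi.2 fun i => continuousOn_mixStat G _
  · exact continuousOn_pi.2 fun i => continuousOn_mixS _

/-- Optimality at the state `x`. -/
def PP (x : X) : Set (KK G) := {z | ∀ (i : Fin n) (θ : Stat G i), RR G i x z.1 (z.2 i).1 θ ≤ 0}

/-- Optimality of the multipliers. -/
def DD : Set (KK G) := {z | ∀ (i : Fin n) (μ : stdSimplex ℝ (Fin (l + 1))),
  ∑ k, (μ.1 k - (z.2 i).1 k) * gg G i k z.1 ≤ 0}

theorem isClosed_PP (hw : Wgt G w δ) (hA : Cnt G w) (hc : ∀ i k, CostOK G w (G.c i k))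
    (hcc : ∀ i k x, ContinuousOn (G.c i k x) (jointSet G x)) (x : X) : IsClosed (PP G x) := by
  simp only [PP, Set.ofPred_forall]
  exact isClosed_iInter fun i => isClosed_iInter fun θ => isClosed_le
    (continuous_RR G hw hA hc hcc i x _ _ continuous_fst _ fun k => continuous_mult G i k)
    continuous_const

theorem isClosed_DD (hw : Wgt G w δ) (hA : Cnt G w) (hc : ∀ i k, CostOK G w (G.c i k))
    (hcc : ∀ i k x, ContinuousOn (G.c i k x) (jointSet G x)) : IsClosed (DD G) := by
  simp only [DD, Set.ofPred_forall]
  exact isClosed_iInter fun i => isClosed_iInter fun μ => isClosed_le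
    (continuous_finsetSum _ fun k _ => (continuous_const.sub (continuous_mult G i k)).mul
      ((continuous_gg G hw hA hc hcc i k).comp continuous_fst))
    continuous_const

theorem mem_DD (hw : Wgt G w δ) (hc : ∀ i k, CostOK G w (G.c i k)) (S : Finset X) (z : KK G)
    (hz : ∀ y, ff G S z y ≤ 0) : z ∈ DD G := by
  intro i μ
  have h := hz (z.1, Function.update z.2 i μ)
  rw [ff, Finset.sum_eq_single i] at h
  · simpa only [RR_self G hw hc, Finset.sum_const_zero, zero_add, Function.update_self] using h
  · intro j _ hj
    simp only [RR_self G hw hc, Finset.sum_const_zero, zero_add, Function.update_of_ne hj,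
      sub_self, zero_mul]
  · intro h; exact absurd (Finset.mem_univ i) h

open Classical in
theorem mem_PP (hw : Wgt G w δ) (hc : ∀ i k, CostOK G w (G.c i k)) (S : Finset X) (z : KK G)
    (hz : ∀ y, ff G S z y ≤ 0) (x : X) (hx : x ∈ S) : z ∈ PP G x := by
  intro i θ
  let θ' : Stat G i := mkStat G (fun y => if y = x then stAt G θ y else stAt G (z.1 i) y)
    (fun y => by split_ifs; exacts [stAt_supp G θ y, stAt_supp G (z.1 i) y])
  have e1 : stAt G θ' x = stAt G θ x := by
    rw [stAt_mkStat, if_pos rfl]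
  have e2 : ∀ y, y ≠ x → stAt G θ' y = stAt G (z.1 i) y := fun y hy => by
    rw [stAt_mkStat, if_neg hy]
  have h := hz (updStat G z.1 i θ', z.2)
  rw [ff, Finset.sum_eq_single i] at h
  · simp only [sub_self, zero_mul, Finset.sum_const_zero, add_zero, updStat_same] at h
    rw [Finset.sum_eq_single x] at h
    · rwa [RR_congr G _ _ i x θ' θ e1] at h
    · intro y _ hy
      rw [RR_congr G _ _ i y θ' (z.1 i) (e2 y hy), RR_self G hw hc]
    · intro h; exact absurd hx h
  · intro j _ hj
    simp only [updStat_ne G _ hj, RR_self G hw hc, Finset.sum_const_zero, zero_add,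
      sub_self, zero_mul]
  · intro h; exact absurd (Finset.mem_univ i) h

theorem exists_point (hw : Wgt G w δ) (hA : Cnt G w) (hc : ∀ i k, CostOK G w (G.c i k))
    (hcc : ∀ i k x, ContinuousOn (G.c i k x) (jointSet G x)) :
    ∃ z : KK G, z ∈ DD G ∧ ∀ x, z ∈ PP G x := by
  obtain ⟨z, hz, hz'⟩ := (isClosed_DD G hw hA hc hcc).isCompact.inter_iInter_nonempty (PP G)
    (isClosed_PP G hw hA hc hcc) fun S => by
      obtain ⟨z, hz⟩ := exists_ff G hw hA hc hcc S
      exact ⟨z, mem_DD G hw hc S z hz, Set.mem_iInter₂.2 fun x hx => mem_PP G hw hc S z hz x hx⟩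
  exact ⟨z, hz, Set.mem_iInter.1 hz'⟩

/-- The Lagrange multiplier argument. -/
theorem multiplier {l : ℕ} {S : Type*} (lam : stdSimplex ℝ (Fin (l + 1)))
    (j0 κ : Fin (l + 1) → ℝ) (js : S → Fin (l + 1) → ℝ)
    (hμ : ∀ μ : stdSimplex ℝ (Fin (l + 1)),
      ∑ k, (μ.1 k - lam.1 k) * (if k = 0 then 0 else j0 k - κ k) ≤ 0)
    (hdev : ∀ s, ∑ k, lam.1 k * j0 k ≤ ∑ k, lam.1 k * js s k)
    (hsl : ∃ s, ∀ k, k ≠ 0 → js s k < κ k) :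
    (∀ k, k ≠ 0 → j0 k ≤ κ k) ∧ ∀ s, (∀ k, k ≠ 0 → js s k ≤ κ k) → j0 0 ≤ js s 0 := by
  obtain ⟨lam, hl0, hl1⟩ := lam
  simp only at hμ hdev
  set g : Fin (l + 1) → ℝ := fun k => if k = 0 then 0 else j0 k - κ k with hg
  have g0 : g 0 = 0 := by simp [hg]
  have gk : ∀ k : Fin l, g k.succ = j0 k.succ - κ k.succ := fun k => by
    simp [hg, Fin.succ_ne_zero]
  obtain ⟨M, hM⟩ : ∃ M, M = ∑ k, lam k * g k := ⟨_, rfl⟩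
  have hv : ∀ k, g k ≤ M := by
    intro k
    have h := hμ ⟨Pi.single k 1, single_mem_stdSimplex ℝ k⟩
    have e : ∑ j, ((Pi.single k 1 : Fin (l + 1) → ℝ) j - lam j) * g j = g k - M := by
      rw [hM]; simp [sub_mul, Finset.sum_sub_distrib, Pi.single_apply]
    have h' : ∑ j, ((Pi.single k 1 : Fin (l + 1) → ℝ) j - lam j) * g j ≤ 0 := h
    linarith
  have hM0 : 0 ≤ M := g0 ▸ hv 0
  rw [Fin.sum_univ_succ, g0, mul_zero, zero_add] at hM
  simp only [gk, mul_sub, Finset.sum_sub_distrib] at hM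
  rw [Fin.sum_univ_succ] at hl1
  simp only [Fin.sum_univ_succ] at hdev
  have hpos : 0 < lam 0 := by
    rcases (hl0 0).lt_or_eq with h | h
    · exact h
    exfalso
    obtain ⟨s, hs⟩ := hsl
    have h1 := hdev s
    rw [← h] at h1 hl1
    have h2 : ∑ k : Fin l, lam k.succ * js s k.succ < ∑ k : Fin l, lam k.succ * κ k.succ := by
      obtain ⟨k, hk⟩ : ∃ k : Fin l, 0 < lam k.succ := by
        by_contra! hcon
        have : ∑ k : Fin l, lam k.succ ≤ 0 := Finset.sum_nonpos fun k _ => hcon k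
        linarith
      exact Finset.sum_lt_sum (fun k _ => mul_le_mul_of_nonneg_left
        (hs _ (Fin.succ_ne_zero k)).le (hl0 _))
        ⟨k, Finset.mem_univ k, mul_lt_mul_of_pos_left (hs _ (Fin.succ_ne_zero k)) hk⟩
    linarith
  have hMle : M ≤ (1 - lam 0) * M := by
    have : ∑ k : Fin l, lam k.succ * (j0 k.succ - κ k.succ) ≤ ∑ k : Fin l, lam k.succ * M :=
      Finset.sum_le_sum fun k _ => mul_le_mul_of_nonneg_left (gk k ▸ hv k.succ) (hl0 _)
    simp only [mul_sub, Finset.sum_sub_distrib] at this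
    rw [← Finset.sum_mul] at this
    have e : ∑ k : Fin l, lam k.succ = 1 - lam 0 := by linarith
    rw [e] at this; linarith
  have hMz : M = 0 := by nlinarith
  refine ⟨fun k hk => ?_, fun s hs => ?_⟩
  · have h := hv k
    simp only [hg, hk, if_false] at h
    linarith
  · have h1 := hdev s
    have h2 : ∑ k : Fin l, lam k.succ * js s k.succ ≤ ∑ k : Fin l, lam k.succ * κ k.succ :=
      Finset.sum_le_sum fun k _ => mul_le_mul_of_nonneg_left (hs _ (Fin.succ_ne_zero k)) (hl0 _)
    have h3 : lam 0 * j0 0 ≤ lam 0 * js s 0 := by linarith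
    exact le_of_mul_le_mul_left h3 hpos

theorem exists_nash (w : X → ℝ) (hA : AssumptionA G) (hW : AssumptionW G w)
    (hC : AssumptionC G) : ∃ φ : StatProfile G, IsNashStat G φ := by
  obtain ⟨h1, hcb, ⟨δ, hδ1, hδ, hp⟩, hwc, hη⟩ := hW
  have hw : Wgt G w δ := ⟨h1, hδ1, hδ, hp, hη⟩
  have hc : ∀ i k, CostOK G w (G.c i k) := fun i k => ⟨G.hc i k, hcb i k⟩
  obtain ⟨z, hD, hP⟩ := exists_point G hw ⟨hA.1, hwc⟩ hc hA.2
  have key := fun i => multiplier (z.2 i) (fun k => J G i k (ofStatAll G z.1)) (G.κ i)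
    (fun (σ : Strategy G i) k => J G i k (combine G (ofStatAll G z.1) i σ))
    (fun μ => hD i μ)
    (fun σ => deviation G hw (G.c i) (hc i) z.1 i (z.2 i).1 (fun x θ => by
      have h := hP x i θ
      simp only [RR, mul_sub, Finset.sum_sub_distrib] at h
      linarith) σ)
    (hC z.1 i)
  exact ⟨z.1, fun i => (key i).1, fun i σ => (key i).2 σ⟩

end Final
end CSGame

open CSGame

namespace CSGame

variable {n l : ℕ}
variable {X : Type} [Countable X] [MeasurableSpace X] [DiscreteMeasurableSpace X]
  [TopologicalSpace X] [DiscreteTopology X] [BorelSpace X] [SecondCountableTopology X]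
variable {A : Fin n → Type} [∀ i, MeasurableSpace (A i)] [∀ i, TopologicalSpace (A i)]
  [∀ i, PolishSpace (A i)] [∀ i, BorelSpace (A i)]
variable (G : GameData n l X A)

/-- Corollary 1. -/
theorem stmt1 (w : X → ℝ) (hA : AssumptionA G) (hW : AssumptionW G w)
    (hC : AssumptionC G) :
    ∃ φ : StatProfile G, IsNashStat G φ := by
  exact exists_nash G w hA hW hC


end CSGame
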